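/- arXiv:2206.09838 — 2 statements merged into one kernel-verified Lean document; each statement's English description precedes it below -/
import Mathlib

section
/- Let (𝒜, τ) be a topological algebra and let (x_n) and (y_n) be sequences in 𝒜 such that, for every convergent sequence (z_n) in 𝒜, the sequences (x_n z_n) and (z_n y_n) converge. Let (a_{mn}) be a double sequence in 𝒜 such that the iterated limit lim_m lim_n a_{mn} exists and equals a, and suppose the iterated limit lim_m lim_n x_m a_{mn} y_n exists and equals η. Then the iterated limit lim_m lim_n x_m a y_n exists and equals η. -/
/- STATEMENT 2 (Lemma aux): iterated-limit exchange lemma in a topological algebra. -/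

open Filter Topology

theorem tendsto_apply_zero_of_converges {A : Type*} [Zero A] [TopologicalSpace A] [T2Space A]
    {f : ℕ → A → A} (hf0 : ∀ n, f n 0 = 0)
    (hf : ∀ z : ℕ → A, (∃ w, Tendsto z atTop (𝓝 w)) →
      ∃ w, Tendsto (fun n => f n (z n)) atTop (𝓝 w))
    {z : ℕ → A} (hz : Tendsto z atTop (𝓝 0)) :
    Tendsto (fun n => f n (z n)) atTop (𝓝 0) := by
  classical
  have key : ∀ p : ℕ → Prop, (∃ᶠ n in atTop, ¬ p n) →
      Tendsto (fun n => f n (if p n then z n else 0)) atTop (𝓝 0) := by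
    intro p hp
    obtain ⟨w, hw⟩ := hf (fun n => if p n then z n else 0) ⟨0, hz.if' tendsto_const_nhds⟩
    have hw0 : w = 0 := by
      by_contra hne
      refine hp ((hw.eventually_ne hne).mono fun n hn hpn => hn ?_)
      simp [hpn, hf0]
    rwa [hw0] at hw
  have heven := key Even (by simpa using Nat.frequently_odd)
  have hodd := key (fun n => ¬ Even n) (by simpa using Nat.frequently_even)
  refine (heven.if' hodd (p := Even)).congr fun n => ?_
  by_cases hn : Even n <;> simp [hn]

theorem tendsto_limits_zero {A : Type*} [Zero A] [TopologicalSpace A] [RegularSpace A]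
    {f : ℕ → A → A}
    (hf : ∀ z : ℕ → A, Tendsto z atTop (𝓝 0) → Tendsto (fun n => f n (z n)) atTop (𝓝 0))
    {v r : ℕ → A} (hv : Tendsto v atTop (𝓝 0))
    (hr : ∀ m, Tendsto (fun n => f n (v m)) atTop (𝓝 (r m))) :
    Tendsto r atTop (𝓝 0) := by
  refine (closed_nhds_basis (0 : A)).tendsto_right_iff.2 fun U ⟨hU, hUc⟩ => ?_
  by_contra hcon
  obtain ⟨φ, hφ, hφU⟩ := extraction_of_frequently_atTop (not_eventually.1 hcon)
  obtain ⟨ψ, hψ, hψU⟩ := extraction_forall_of_eventually fun k =>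
    (hr (φ k)).eventually (hUc.isOpen_compl.mem_nhds (hφU k))
  have hz : Tendsto (Function.extend ψ (v ∘ φ) 0) atTop (𝓝 0) := by
    intro V hV
    obtain ⟨K, hK⟩ := eventually_atTop.1 ((hv.comp hφ.tendsto_atTop).eventually hV)
    refine eventually_atTop.2 ⟨ψ K, fun n hn => ?_⟩
    by_cases hex : ∃ k, ψ k = n
    · obtain ⟨k, rfl⟩ := hex
      rw [hψ.injective.extend_apply]
      exact hK k (hψ.le_iff_le.1 hn)
    · rw [Function.extend_apply' _ _ _ hex]
      exact mem_of_mem_nhds hV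
  obtain ⟨k, hk⟩ := (((hf _ hz).comp hψ.tendsto_atTop).eventually hU).exists
  refine hψU k ?_
  rw [Function.comp_apply, hψ.injective.extend_apply] at hk
  exact hk

theorem iterated_limit_factorization
    {𝒜 : Type*} [Ring 𝒜] [Module ℝ 𝒜] [TopologicalSpace 𝒜]
    -- (𝒜, τ) is a Hausdorff locally convex topological vector space:
    [IsTopologicalAddGroup 𝒜] [ContinuousSMul ℝ 𝒜] [T2Space 𝒜] [LocallyConvexSpace ℝ 𝒜]
    -- multiplication is separately continuous:
    (hmulL : ∀ a : 𝒜, Continuous (fun b => a * b))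
    (hmulR : ∀ a : 𝒜, Continuous (fun b => b * a))
    -- the sequences (x n) and (y n):
    (x y : ℕ → 𝒜)
    (hx : ∀ z : ℕ → 𝒜, (∃ w, Tendsto z atTop (𝓝 w)) →
      ∃ w, Tendsto (fun n => x n * z n) atTop (𝓝 w))
    (hy : ∀ z : ℕ → 𝒜, (∃ w, Tendsto z atTop (𝓝 w)) →
      ∃ w, Tendsto (fun n => z n * y n) atTop (𝓝 w))
    -- the double sequence (a m n) with iterated limit a:
    (a : ℕ → ℕ → 𝒜) (aRow : ℕ → 𝒜) (aLim : 𝒜)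
    (haRow : ∀ m, Tendsto (fun n => a m n) atTop (𝓝 (aRow m)))
    (haLim : Tendsto aRow atTop (𝓝 aLim))
    -- the iterated limit lim_m lim_n x m * a m n * y n exists and equals η:
    (b : ℕ → 𝒜) (η : 𝒜)
    (hbRow : ∀ m, Tendsto (fun n => x m * a m n * y n) atTop (𝓝 (b m)))
    (hbLim : Tendsto b atTop (𝓝 η)) :
    -- then lim_m lim_n x m * a * y n exists and equals η:
    ∃ c : ℕ → 𝒜, (∀ m, Tendsto (fun n => x m * aLim * y n) atTop (𝓝 (c m))) ∧
      Tendsto c atTop (𝓝 η) := by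
  have hx0 : ∀ z : ℕ → 𝒜, Tendsto z atTop (𝓝 0) → Tendsto (fun n => x n * z n) atTop (𝓝 0) :=
    fun z hz => tendsto_apply_zero_of_converges (f := fun n u => x n * u) (by simp) hx hz
  have hy0 : ∀ z : ℕ → 𝒜, Tendsto z atTop (𝓝 0) → Tendsto (fun n => z n * y n) atTop (𝓝 0) :=
    fun z hz => tendsto_apply_zero_of_converges (f := fun n u => u * y n) (by simp) hy hz
  choose c hc using fun m => hy (fun _ => x m * aLim) ⟨_, tendsto_const_nhds⟩
  refine ⟨c, hc, ?_⟩
  have hv : Tendsto (fun m => x m * (aRow m - aLim)) atTop (𝓝 0) :=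
    hx0 _ (tendsto_sub_nhds_zero_iff.2 haLim)
  have hr : ∀ m, Tendsto (fun n => x m * (aRow m - aLim) * y n) atTop (𝓝 (b m - c m)) := by
    intro m
    have hz : Tendsto (fun n => x m * (a m n - aRow m)) atTop (𝓝 0) := by
      have h := ((hmulL (x m)).tendsto 0).comp (tendsto_sub_nhds_zero_iff.2 (haRow m))
      simpa only [mul_zero, Function.comp_def] using h
    have h := ((hbRow m).sub (hy0 _ hz)).sub (hc m)
    rw [sub_zero] at h
    exact h.congr fun n => by noncomm_ring
  have hbc := tendsto_limits_zero (f := fun n u => u * y n) hy0 hv hr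
  simpa using hbLim.sub hbc
end

section
/- Let (X_i)_{i=1}^𝔪 be a sequence of infinite-dimensional separable purely atomic Banach lattices satisfying (⋆) for the same constant μ, let 𝐞 be a 1-unconditional basis with 𝔪 terms, and let X := (⊕_i X_i)_𝐞 (such X is order complete, so ℒʳ(X) is a Banach lattice algebra). Let 𝒜 be a closed Riesz algebra ideal of ℒʳ(X) such that {ab : a, b ∈ 𝒜} = 𝒜, and let 𝔛 be a Banach lattice 𝒜-module with dual Banach lattice 𝒜-module 𝔛′. Let (x_i) be a basis for X satisfying (⋆) with constant μ in each summand, let (x_i*) be its biorthogonal functionals, q_i := x_i*⊗x_i and e_n := ∑_{i=1}^n q_i. Assume: (1) (x_i) is shrinking; (2) the linear maps E, F : 𝔛′ → 𝔛′ determined by Ex′ = sup_n e_n·x′ and Fx′ = sup_n x′·e_n for x′ ∈ 𝔛′₊ have weak*-closed ranges; (3) sup_n e_n·(a·x′) = a·x′ and sup_n (x′·a)·e_n = x′·a for all a ∈ 𝒜₊ and x′ ∈ 𝔛′₊; (4) at least one of the following holds: (i) for each i ∈ ℕ, no sequence (ξ_n) in 𝔛′ with ξ_n ∈ q_n·𝔛′·q_i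 for all n, or with ξ_n ∈ q_i·𝔛′·q_n for all n, has a subsequence equivalent to the unit vector basis of c₀; (ii) X is reflexive and dim(q_i·𝔛′·q_j) < ∞ for some (equivalently, for every) pair i, j ∈ ℕ; (iii) every bounded derivation from 𝒜ʳ(X) to 𝔛′ is inner. Then every bounded derivation D : 𝒜 → 𝔛′ is regular. -/
/- STATEMENT 3 (Theorem atomicmain): automatic regularity of bounded derivations
   from a closed Riesz algebra ideal 𝒜 of ℒʳ(X), X an 𝐞-direct sum of atomic
   Banach lattices with property (⋆), into the dual of a Banach lattice 𝒜-module. -/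

open Filter Topology

section Prelude

variable {X 𝔛 : Type*} [NormedAddCommGroup X] [Lattice X] [HasSolidNorm X] [IsOrderedAddMonoid X] [NormedSpace ℝ X]
variable [NormedAddCommGroup 𝔛] [Lattice 𝔛] [HasSolidNorm 𝔛] [IsOrderedAddMonoid 𝔛] [NormedSpace ℝ 𝔛]

/-- A bounded operator is positive if it maps the positive cone into itself. -/
def IsPosOp (T : X →L[ℝ] X) : Prop := ∀ x : X, 0 ≤ x → 0 ≤ T x

/-- The operator order on regular operators. -/
def opLe (S T : X →L[ℝ] X) : Prop := IsPosOp (T - S)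

/-- ℒʳ(X): the regular operators, i.e. linear combinations of positive operators. -/
def LrSet (X : Type*) [NormedAddCommGroup X] [Lattice X] [HasSolidNorm X] [IsOrderedAddMonoid X] [NormedSpace ℝ X] :
    Set (X →L[ℝ] X) :=
  {T | ∃ (n : ℕ) (c : Fin n → ℝ) (S : Fin n → X →L[ℝ] X),
    (∀ i, IsPosOp (S i)) ∧ T = ∑ i, c i • S i}

/-- The regular norm ‖T‖ᵣ = inf{‖S‖ : |Tx| ≤ S|x| for all x}. -/
noncomputable def rnorm (T : X →L[ℝ] X) : ℝ :=
  sInf {c : ℝ | ∃ S : X →L[ℝ] X, ‖S‖ = c ∧ ∀ x : X, |T x| ≤ S |x|}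

/-- ℱ(X): continuous finite-rank operators. -/
def FinRankOp (T : X →L[ℝ] X) : Prop :=
  ∃ (n : ℕ) (f : Fin n → X →L[ℝ] ℝ) (v : Fin n → X), T = ∑ i, (f i).smulRight (v i)

/-- 𝒜ʳ(X): the ‖·‖ᵣ-closure of ℱ(X) in ℒʳ(X). -/
def ArSet (X : Type*) [NormedAddCommGroup X] [Lattice X] [HasSolidNorm X] [IsOrderedAddMonoid X] [NormedSpace ℝ X] :
    Set (X →L[ℝ] X) :=
  {T | T ∈ LrSet X ∧ ∀ ε : ℝ, 0 < ε → ∃ F : X →L[ℝ] X, FinRankOp F ∧ rnorm (T - F) < ε}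

/-- x is a normalized atom of the Banach lattice X. -/
def IsNormAtom (a : X) : Prop :=
  0 < a ∧ ‖a‖ = 1 ∧ ∀ y : X, 0 ≤ y → y ≤ a → ∃ c : ℝ, y = c • a

/-- The dual (pointwise-on-the-cone) order on 𝔛′ = 𝔛 →L[ℝ] ℝ. -/
def dualLe (f g : 𝔛 →L[ℝ] ℝ) : Prop := ∀ y : 𝔛, 0 ≤ y → f y ≤ g y

/-- Least upper bound with respect to the dual order. -/
def dualIsLUB (S : Set (𝔛 →L[ℝ] ℝ)) (f : 𝔛 →L[ℝ] ℝ) : Prop :=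
  (∀ g ∈ S, dualLe g f) ∧ ∀ h : 𝔛 →L[ℝ] ℝ, (∀ g ∈ S, dualLe g h) → dualLe f h

/-- A subset of the dual is weak*-closed. -/
def wstarClosed (S : Set (𝔛 →L[ℝ] ℝ)) : Prop :=
  IsClosed (StrongDual.toWeakDual '' S)

/-- (y i)_{i<n} and (z i)_{i<n} are L-equivalent. -/
def seqEquivUpTo (L : ℝ) (n : ℕ) (y z : ℕ → X) : Prop :=
  ∀ α : ℕ → ℝ,
    ‖∑ i ∈ Finset.range n, α i • y i‖ ≤ L * ‖∑ i ∈ Finset.range n, α i • z i‖ ∧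
    ‖∑ i ∈ Finset.range n, α i • z i‖ ≤ L * ‖∑ i ∈ Finset.range n, α i • y i‖

/-- The sequence (x i) satisfies the selection property (⋆) with constant μ. -/
def StarSeq (μ : ℝ) (x : ℕ → X) : Prop :=
  ∃ μs : ℕ → ℝ, (∀ n, 1 ≤ μs n ∧ μs n ≤ μ) ∧
    ∀ (n : ℕ) (l : ℕ → ℕ), 0 < n → (∀ i j, i < j → j < n → l i < l j) →
      seqEquivUpTo (μs n) n x (fun i => x (l i)) →
      ∀ k : ℕ, ∃ m : ℕ, l (n - 1) + k ≤ m ∧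
        seqEquivUpTo (μs (n + 1)) (n + 1) x (fun i => x (Function.update l n m i))

/-- (x i) is (an enumeration of the normalized atoms of X forming) a basis for
X = (⊕_n X_n)_𝐞 satisfying (⋆) with constant μ in each summand: there is a partition
of ℕ into slices (ψ n ·), n ∈ I, order preserving on each slice, such that on each
slice the (⋆)-property holds with constant μ, the slices are pairwise disjoint
sublattices, and the decomposition into slices is 1-unconditional. -/
def StarSummandBasis (μ : ℝ) (x : ℕ → X) : Prop :=
  ∃ (I : Set ℕ) (ψ : ℕ → ℕ → ℕ),
    (∀ n ∈ I, StrictMono (ψ n)) ∧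
    (∀ i : ℕ, ∃! p : ℕ × ℕ, p.1 ∈ I ∧ ψ p.1 p.2 = i) ∧
    (∀ n ∈ I, StarSeq μ (fun j => x (ψ n j))) ∧
    (∀ i, IsNormAtom (x i)) ∧
    (∀ a : X, IsNormAtom a → ∃ i, x i = a) ∧
    (∀ n ∈ I, ∀ m ∈ I, n ≠ m → ∀ j j' : ℕ, x (ψ n j) ⊓ x (ψ m j') = 0) ∧
    (∀ (s : Finset ℕ) (α ε : ℕ → ℝ),
      (∀ n ∈ I, ∀ j j' : ℕ, ε (ψ n j) = ε (ψ n j')) → (∀ i, |ε i| ≤ 1) →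
      ‖∑ i ∈ s, (ε i * α i) • x i‖ ≤ ‖∑ i ∈ s, α i • x i‖)

/-- A sequence in the dual is equivalent to the unit vector basis of c₀. -/
def EquivC0Basis (ξ : ℕ → (𝔛 →L[ℝ] ℝ)) : Prop :=
  ∃ L : ℝ, 0 < L ∧ ∀ (m : ℕ) (α : ℕ → ℝ),
    (∀ j < m, |α j| ≤ L * ‖∑ i ∈ Finset.range m, α i • ξ i‖) ∧
    (∀ B : ℝ, 0 ≤ B → (∀ i < m, |α i| ≤ B) →
      ‖∑ i ∈ Finset.range m, α i • ξ i‖ ≤ L * B)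

/-- A map D defined (at least) on A ⊆ ℒʳ(X), with values in 𝔛′, is regular if on A it
is a finite linear combination of positive linear maps. -/
def RegularDerivOn (A : Set (X →L[ℝ] X)) (D : (X →L[ℝ] X) → (𝔛 →L[ℝ] ℝ)) : Prop :=
  ∃ (n : ℕ) (c : Fin n → ℝ) (P : Fin n → (X →L[ℝ] X) → (𝔛 →L[ℝ] ℝ)),
    (∀ t, (∀ a ∈ A, ∀ b ∈ A, P t (a + b) = P t a + P t b) ∧
          (∀ (r : ℝ), ∀ a ∈ A, P t (r • a) = r • P t a) ∧
          (∀ a ∈ A, IsPosOp a → dualLe 0 (P t a))) ∧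
    ∀ a ∈ A, D a = ∑ t, c t • P t a

/-- 𝔛 contains a complemented subspace isomorphic to ℓ₁. -/
def HasComplementedL1 (𝔛 : Type*) [NormedAddCommGroup 𝔛] [Lattice 𝔛] [HasSolidNorm 𝔛] [IsOrderedAddMonoid 𝔛] [NormedSpace ℝ 𝔛] :
    Prop :=
  ∃ (P : 𝔛 →L[ℝ] 𝔛) (e : ℕ → 𝔛) (L : ℝ), 0 < L ∧ P ∘L P = P ∧
    (∀ y : 𝔛, P y ∈ closure (Submodule.span ℝ (Set.range e) : Set 𝔛)) ∧
    (∀ i, P (e i) = e i) ∧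
    (∀ (m : ℕ) (α : ℕ → ℝ),
      L⁻¹ * ∑ i ∈ Finset.range m, |α i| ≤ ‖∑ i ∈ Finset.range m, α i • e i‖ ∧
      ‖∑ i ∈ Finset.range m, α i • e i‖ ≤ L * ∑ i ∈ Finset.range m, |α i|)

end Prelude

set_option linter.unusedSectionVars false

section LatticeLemmas

variable {Y : Type*} [NormedAddCommGroup Y] [Lattice Y] [HasSolidNorm Y] [IsOrderedAddMonoid Y]
  [NormedSpace ℝ Y]

lemma nonneg_of_pow_two_nsmul_nonneg (n : ℕ) {y : Y} (h : 0 ≤ 2 ^ n • y) : 0 ≤ y := by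
  induction n with
  | zero => simpa using h
  | succ k ih =>
    refine ih (nsmul_two_semiclosed ?_)
    rwa [← mul_nsmul, ← pow_succ]

/-- In a normed lattice, nonnegative scalars preserve the positive cone. -/
lemma solid_smul_nonneg {r : ℝ} (hr : 0 ≤ r) {y : Y} (hy : 0 ≤ y) : 0 ≤ r • y := by
  have hlim : Tendsto (fun n : ℕ => ((⌊r * (2 : ℝ) ^ n⌋₊ : ℝ) / (2 : ℝ) ^ n) • y) atTop
      (𝓝 (r • y)) :=
    ((tendsto_nat_floor_mul_div_atTop hr).comp
      (tendsto_pow_atTop_atTop_of_one_lt (one_lt_two : (1 : ℝ) < 2))).smul_const y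
  refine ge_of_tendsto' hlim fun n => ?_
  refine nonneg_of_pow_two_nsmul_nonneg n ?_
  rw [← Nat.cast_smul_eq_nsmul ℝ, smul_smul]
  push_cast
  rw [mul_div_cancel₀ _ (by positivity), Nat.cast_smul_eq_nsmul ℝ]
  exact nsmul_nonneg hy _

lemma solid_smul_le_smul_left {r : ℝ} (hr : 0 ≤ r) {y z : Y} (h : y ≤ z) : r • y ≤ r • z := by
  have := solid_smul_nonneg hr (sub_nonneg.2 h)
  rwa [smul_sub, sub_nonneg] at this

lemma solid_smul_le_smul_right {r s : ℝ} (h : r ≤ s) {y : Y} (hy : 0 ≤ y) : r • y ≤ s • y := by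
  have := solid_smul_nonneg (sub_nonneg.2 h) hy
  rwa [sub_smul, sub_nonneg] at this

lemma solid_abs_smul_le (r : ℝ) (y : Y) : |r • y| ≤ |r| • |y| := by
  rcases abs_cases r with ⟨h, h'⟩ | ⟨h, h'⟩ <;> rw [h]
  · refine abs_le'.2 ⟨solid_smul_le_smul_left h' (le_abs_self y), ?_⟩
    rw [← smul_neg]
    exact solid_smul_le_smul_left h' (neg_le_abs y)
  · have h'' : 0 ≤ -r := by linarith
    refine abs_le'.2 ⟨?_, ?_⟩
    · rw [← neg_smul_neg]
      exact solid_smul_le_smul_left h'' (neg_le_abs y)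
    · rw [← neg_smul]
      exact solid_smul_le_smul_left h'' (le_abs_self y)

/-- Riesz decomposition: an element dominated by a sum splits accordingly. -/
lemma exists_abs_le_add_abs_le {z u v : Y} (hu : 0 ≤ u) (hv : 0 ≤ v) (h : |z| ≤ u + v) :
    ∃ z₁ z₂ : Y, z = z₁ + z₂ ∧ |z₁| ≤ u ∧ |z₂| ≤ v := by
  obtain ⟨h1, h2⟩ := abs_le'.1 h
  refine ⟨(z ⊓ u) ⊔ (-u), z - ((z ⊓ u) ⊔ (-u)), by abel, ?_, ?_⟩
  · refine abs_le'.2 ⟨sup_le inf_le_right ?_, neg_le.1 le_sup_right⟩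
    exact (neg_nonpos.2 hu).trans hu
  · refine abs_le'.2 ⟨?_, neg_le.1 ?_⟩
    rotate_left
    · rw [le_sub_comm]
      refine sup_le (inf_le_left.trans ?_) ?_
      · simpa using hv
      · rw [sub_neg_eq_add, ← sub_nonneg]
        have := sub_nonneg.2 h2
        convert this using 1
        abel
    · rw [sub_le_iff_le_add, ← sub_le_iff_le_add']
      refine le_sup_of_le_left (le_inf ?_ ?_)
      · simpa using hv
      · rw [sub_le_iff_le_add']
        rwa [add_comm]

lemma dual_mono {f : Y →L[ℝ] ℝ} (hf : dualLe 0 f) {y z : Y} (h : y ≤ z) : f y ≤ f z := by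
  have := hf (z - y) (sub_nonneg.2 h)
  simpa using this

/-- The value of the modulus of a functional at a positive vector. -/
noncomputable def modulusOnCone (f : Y →L[ℝ] ℝ) (y : Y) : ℝ := sSup (f '' {z | |z| ≤ y})

variable (f : Y →L[ℝ] ℝ)

lemma le_norm_mul_of_abs_le {y z : Y} (h : |z| ≤ y) : f z ≤ ‖f‖ * ‖y‖ :=
  (le_abs_self _).trans <| (f.le_opNorm z).trans <| by
    refine mul_le_mul_of_nonneg_left ?_ (norm_nonneg _)
    exact HasSolidNorm.solid (h.trans (le_abs_self y))

lemma le_modulusOnCone {y z : Y} (h : |z| ≤ y) : f z ≤ modulusOnCone f y :=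
  le_csSup ⟨‖f‖ * ‖y‖, by rintro _ ⟨w, hw, rfl⟩; exact le_norm_mul_of_abs_le f hw⟩ ⟨z, h, rfl⟩

lemma modulusOnCone_le {y : Y} (hy : 0 ≤ y) {c : ℝ} (h : ∀ z, |z| ≤ y → f z ≤ c) :
    modulusOnCone f y ≤ c :=
  csSup_le ⟨f 0, 0, by simpa using hy, rfl⟩ (by rintro _ ⟨w, hw, rfl⟩; exact h w hw)

lemma modulusOnCone_nonneg {y : Y} (hy : 0 ≤ y) : 0 ≤ modulusOnCone f y := by
  simpa using le_modulusOnCone f (y := y) (z := 0) (by simpa using hy)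

lemma modulusOnCone_add {u v : Y} (hu : 0 ≤ u) (hv : 0 ≤ v) :
    modulusOnCone f (u + v) = modulusOnCone f u + modulusOnCone f v := by
  apply le_antisymm
  · refine modulusOnCone_le f (add_nonneg hu hv) fun z hz => ?_
    obtain ⟨z₁, z₂, rfl, h1, h2⟩ := exists_abs_le_add_abs_le hu hv hz
    rw [map_add]
    exact add_le_add (le_modulusOnCone f h1) (le_modulusOnCone f h2)
  · rw [← le_sub_iff_add_le]
    refine modulusOnCone_le f hu fun z hz => ?_
    rw [le_sub_comm]
    refine modulusOnCone_le f hv fun w hw => ?_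
    rw [le_sub_iff_add_le', ← map_add]
    exact le_modulusOnCone f ((abs_add_le z w).trans (add_le_add hz hw))

lemma modulusOnCone_sub_eq {y u v : Y} (hu : 0 ≤ u) (hv : 0 ≤ v) (h : y = u - v) :
    modulusOnCone f y⁺ - modulusOnCone f y⁻ = modulusOnCone f u - modulusOnCone f v := by
  rw [sub_eq_sub_iff_add_eq_add, ← modulusOnCone_add f (posPart_nonneg y) hv,
    ← modulusOnCone_add f hu (negPart_nonneg y)]
  congr 1
  rw [← sub_eq_sub_iff_add_eq_add, posPart_sub_negPart, h]

/-- Every functional on a normed lattice has a modulus in the dual. -/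
lemma exists_dual_modulus :
    ∃ g : Y →L[ℝ] ℝ, dualLe 0 g ∧ dualLe f g ∧ dualLe (-f) g ∧ ‖g‖ ≤ ‖f‖ ∧
      ∀ h : Y →L[ℝ] ℝ, dualLe f h → dualLe (-f) h → dualLe g h := by
  let G : Y →+ ℝ := AddMonoidHom.mk' (fun y => modulusOnCone f y⁺ - modulusOnCone f y⁻) (by
    intro y z
    rw [modulusOnCone_sub_eq f (y := y + z) (u := y⁺ + z⁺) (v := y⁻ + z⁻)
      (add_nonneg (posPart_nonneg _) (posPart_nonneg _))
      (add_nonneg (negPart_nonneg _) (negPart_nonneg _))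
      (by
        nth_rewrite 1 [← posPart_sub_negPart y, ← posPart_sub_negPart z]
        abel),
      modulusOnCone_add f (posPart_nonneg _) (posPart_nonneg _),
      modulusOnCone_add f (negPart_nonneg _) (negPart_nonneg _)]
    ring)
  have hG : ∀ y, 0 ≤ y → G y = modulusOnCone f y := by
    intro y hy
    have := modulusOnCone_sub_eq f (y := y) hy le_rfl (by simp)
    have h0 : modulusOnCone f (0 : Y) = 0 := by
      have := modulusOnCone_add f (le_refl (0 : Y)) le_rfl
      simpa using this
    rw [h0, sub_zero] at this
    exact this
  have hbd : ∀ y, ‖G y‖ ≤ ‖f‖ * ‖y‖ := by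
    intro y
    have hp := modulusOnCone_nonneg f (posPart_nonneg y)
    have hn := modulusOnCone_nonneg f (negPart_nonneg y)
    have hsum : modulusOnCone f y⁺ + modulusOnCone f y⁻ = modulusOnCone f |y| := by
      rw [← modulusOnCone_add f (posPart_nonneg y) (negPart_nonneg y), posPart_add_negPart]
    have hle : modulusOnCone f |y| ≤ ‖f‖ * ‖y‖ := by
      refine modulusOnCone_le f (abs_nonneg y) fun z hz => ?_
      rw [← norm_abs_eq_norm y]
      exact le_norm_mul_of_abs_le f hz
    change |modulusOnCone f y⁺ - modulusOnCone f y⁻| ≤ _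
    rw [abs_le]
    constructor <;> linarith
  have hcont : Continuous G := AddMonoidHomClass.continuous_of_bound G ‖f‖ hbd
  have hself : ∀ y : Y, 0 ≤ y → |y| ≤ y ∧ |-y| ≤ y := fun y hy => by
    rw [abs_neg, abs_of_nonneg hy]; exact ⟨le_rfl, le_rfl⟩
  refine ⟨G.toRealLinearMap hcont, ?_, ?_, ?_, ?_, ?_⟩
  · intro y hy
    change 0 ≤ G y
    rw [hG y hy]
    exact modulusOnCone_nonneg f hy
  · intro y hy
    change f y ≤ G y
    rw [hG y hy]
    exact le_modulusOnCone f (hself y hy).1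
  · intro y hy
    change -f y ≤ G y
    rw [hG y hy, ← map_neg]
    exact le_modulusOnCone f (hself y hy).2
  · exact ContinuousLinearMap.opNorm_le_bound _ (norm_nonneg f) hbd
  · intro h h1 h2 y hy
    change G y ≤ h y
    rw [hG y hy]
    have hpos : dualLe 0 h := fun z hz => by
      have a := h1 z hz
      have b := h2 z hz
      simp only [neg_apply] at b
      simp only [zero_apply]
      linarith
    refine modulusOnCone_le f hy fun z hz => ?_
    have a := h1 _ (posPart_nonneg z)
    have b := h2 _ (negPart_nonneg z)
    simp only [neg_apply] at b
    calc f z = f z⁺ - f z⁻ := by rw [← map_sub, posPart_sub_negPart]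
      _ ≤ h z⁺ + h z⁻ := by linarith
      _ = h |z| := by rw [← map_add, posPart_add_negPart]
      _ ≤ h y := dual_mono hpos hz

end LatticeLemmas

section UltrafilterLimits

variable {Y : Type*} [NormedAddCommGroup Y] [NormedSpace ℝ Y]

/-- Weak* convergence of a sequence of functionals along the hyperfilter on `ℕ`. -/
def UltraLim (φ : ℕ → (Y →L[ℝ] ℝ)) (ψ : Y →L[ℝ] ℝ) : Prop :=
  ∀ y, Tendsto (fun n => φ n y) (hyperfilter ℕ : Filter ℕ) (𝓝 (ψ y))

lemma exists_ultraLim {φ : ℕ → (Y →L[ℝ] ℝ)} {K : ℝ} (h : ∀ n, ‖φ n‖ ≤ K) :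
    ∃ ψ, UltraLim φ ψ := by
  have hc := WeakDual.isCompact_closedBall (𝕜 := ℝ) (E := Y) 0 K
  obtain ⟨ψ, -, hψ⟩ := hc.ultrafilter_le_nhds
    ((hyperfilter ℕ).map fun n => StrongDual.toWeakDual (φ n)) (by
      rw [le_principal_iff]
      refine Ultrafilter.mem_map.2 (Filter.univ_mem' fun n => ?_)
      simpa using h n)
  refine ⟨WeakDual.toStrongDual ψ, fun y => ?_⟩
  have : Tendsto (fun n => StrongDual.toWeakDual (φ n)) (hyperfilter ℕ : Filter ℕ) (𝓝 ψ) := hψ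
  exact ((WeakDual.eval_continuous y).tendsto ψ).comp this

lemma UltraLim.unique {φ : ℕ → (Y →L[ℝ] ℝ)} {ψ ψ' : Y →L[ℝ] ℝ} (h : UltraLim φ ψ)
    (h' : UltraLim φ ψ') : ψ = ψ' :=
  ContinuousLinearMap.ext fun y => tendsto_nhds_unique (h y) (h' y)

lemma UltraLim.add {φ φ' : ℕ → (Y →L[ℝ] ℝ)} {ψ ψ' : Y →L[ℝ] ℝ} (h : UltraLim φ ψ)
    (h' : UltraLim φ' ψ') : UltraLim (fun n => φ n + φ' n) (ψ + ψ') :=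
  fun y => (h y).add (h' y)

lemma UltraLim.sub {φ φ' : ℕ → (Y →L[ℝ] ℝ)} {ψ ψ' : Y →L[ℝ] ℝ} (h : UltraLim φ ψ)
    (h' : UltraLim φ' ψ') : UltraLim (fun n => φ n - φ' n) (ψ - ψ') :=
  fun y => (h y).sub (h' y)

lemma UltraLim.const_smul {φ : ℕ → (Y →L[ℝ] ℝ)} {ψ : Y →L[ℝ] ℝ} (h : UltraLim φ ψ) (c : ℝ) :
    UltraLim (fun n => c • φ n) (c • ψ) :=
  fun y => (h y).const_smul c

lemma UltraLim.of_eventuallyEq {φ φ' : ℕ → (Y →L[ℝ] ℝ)} {ψ : Y →L[ℝ] ℝ} (h : UltraLim φ ψ)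
    (hh : ∀ᶠ n in atTop, φ' n = φ n) : UltraLim φ' ψ := fun y =>
  (h y).congr' ((hh.filter_mono Nat.hyperfilter_le_atTop).mono fun n hn => by simp only [hn])

lemma ultraLim_const (ψ : Y →L[ℝ] ℝ) : UltraLim (fun _ => ψ) ψ := fun _ => tendsto_const_nhds

lemma ultraLim_of_tendsto_norm {φ : ℕ → (Y →L[ℝ] ℝ)} {ψ : Y →L[ℝ] ℝ}
    (h : Tendsto (fun n => ‖ψ - φ n‖) atTop (𝓝 0)) : UltraLim φ ψ := fun y => by
  have h1 : Tendsto φ atTop (𝓝 ψ) := by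
    rw [tendsto_iff_norm_sub_tendsto_zero]
    simpa only [norm_sub_rev] using h
  have h2 : Tendsto (fun n => φ n y) atTop (𝓝 (ψ y)) :=
    ((ContinuousLinearMap.apply ℝ ℝ y).continuous.tendsto ψ).comp h1
  exact h2.mono_left Nat.hyperfilter_le_atTop

end UltrafilterLimits

section AbstractDerivations

variable {S : Type*} [NonUnitalRing S] [Module ℝ S]

section Identities

variable {W : Type*} [AddCommGroup W] [Module ℝ W]
  {L R : S →ₗ[ℝ] W →ₗ[ℝ] W} {D : S →ₗ[ℝ] W} {q : ℕ → S}

lemma mul_sum_range_of_orthogonal (hq : ∀ i j, q i * q j = if i = j then q i else 0) {k n : ℕ}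
    (hk : k < n) : q k * ∑ i ∈ Finset.range n, q i = q k := by
  simp [Finset.mul_sum, hq, hk]

lemma sum_range_mul_of_orthogonal (hq : ∀ i j, q i * q j = if i = j then q i else 0) {k n : ℕ}
    (hk : k < n) : (∑ i ∈ Finset.range n, q i) * q k = q k := by
  simp [Finset.sum_mul, hq, hk]

lemma sum_range_idempotent (hq : ∀ i j, q i * q j = if i = j then q i else 0) (n : ℕ) :
    (∑ i ∈ Finset.range n, q i) * ∑ i ∈ Finset.range n, q i = ∑ i ∈ Finset.range n, q i := by
  rw [Finset.sum_mul]
  exact Finset.sum_congr rfl fun i hi =>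
    mul_sum_range_of_orthogonal hq (Finset.mem_range.1 hi)

/-- An explicit element implementing a derivation on finitely many orthogonal idempotents. -/
lemma derivation_eq_commutator_on_idempotents
    (hL : ∀ a b v, L (a * b) v = L a (L b v)) (hR : ∀ a b v, R (a * b) v = R b (R a v))
    (hLR : ∀ a b v, L a (R b v) = R b (L a v)) (hD : ∀ a b, D (a * b) = L a (D b) + R b (D a))
    (hq : ∀ i j, q i * q j = if i = j then q i else 0) {k n : ℕ} (hk : k < n) {e : S}
    (he : e = ∑ i ∈ Finset.range n, q i) {η : W}
    (hη : η = ∑ i ∈ Finset.range n, L (q i) (D (q i)) - R e (D e)) :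
    L (q k) η - R (q k) η = D (q k) := by
  have hqe : q k * e = q k := he ▸ mul_sum_range_of_orthogonal hq hk
  have heq : e * q k = q k := he ▸ sum_range_mul_of_orthogonal hq hk
  have hee : e * e = e := he ▸ sum_range_idempotent hq n
  have h1 : L (q k) (∑ i ∈ Finset.range n, L (q i) (D (q i))) = L (q k) (D (q k)) := by
    rw [map_sum, Finset.sum_eq_single k]
    · rw [← hL, hq, if_pos rfl]
    · intro i _ hik
      rw [← hL, hq, if_neg (Ne.symm hik), map_zero, LinearMap.zero_apply]
    · intro h
      exact absurd (Finset.mem_range.2 hk) h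
  have h2 : L (q k) (R e (D e)) = 0 := by
    have h := hD (q k) e
    rw [hqe] at h
    rw [hLR, ← sub_eq_iff_eq_add.2 h, map_sub, ← hR, hee, sub_self]
  have h3 : R (q k) (∑ i ∈ Finset.range n, L (q i) (D (q i)))
      = L (q k) (D (q k)) - L e (D (q k)) := by
    have hterm : ∀ i, R (q k) (L (q i) (D (q i)))
        = (if i = k then L (q k) (D (q k)) else 0) - L (q i) (D (q k)) := by
      intro i
      have h := hD (q i) (q k)
      rw [← hLR, eq_sub_of_add_eq' h.symm, map_sub, ← hL, hq i i, if_pos rfl, hq]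
      split_ifs with hik
      · rw [hik]
      · rw [map_zero, map_zero]
    rw [map_sum, Finset.sum_congr rfl fun i _ => hterm i, Finset.sum_sub_distrib,
      Finset.sum_ite_eq' , if_pos (Finset.mem_range.2 hk), he, map_sum, LinearMap.sum_apply]
  have h4 : R (q k) (R e (D e)) = D (q k) - L e (D (q k)) := by
    have h := hD e (q k)
    rw [heq] at h
    rw [← hR, heq, eq_sub_of_add_eq' h.symm]
  rw [hη, map_sub, map_sub, h1, h2, h3, h4]
  abel

end Identities

/-- A diagonal sum is bounded by the sign-twisted full sums. -/
lemma norm_add_diagonal_sum_le {W : Type*} [NormedAddCommGroup W] [NormedSpace ℝ W]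
    (b : ℕ → ℕ → W) (K : ℝ) (n : ℕ) : ∀ c : W,
    (∀ ε : ℕ → ℝ, (∀ i, ε i = 1 ∨ ε i = -1) →
      ‖c + ∑ i ∈ Finset.range n, ∑ j ∈ Finset.range n, (ε i * ε j) • b i j‖ ≤ K) →
    ‖c + ∑ i ∈ Finset.range n, b i i‖ ≤ K := by
  induction n with
  | zero => intro c h; simpa using h 1 (fun _ => Or.inl rfl)
  | succ n ih =>
    intro c h
    rw [Finset.sum_range_succ, add_comm (∑ i ∈ Finset.range n, b i i), ← add_assoc]
    refine ih _ fun ε hε => ?_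
    have key : ∀ s : ℝ, (s = 1 ∨ s = -1) →
        ‖(c + b n n + ∑ i ∈ Finset.range n, ∑ j ∈ Finset.range n, (ε i * ε j) • b i j)
          + s • (∑ i ∈ Finset.range n, ε i • b i n + ∑ j ∈ Finset.range n, ε j • b n j)‖ ≤ K := by
      intro s hs
      have hss : s * s = 1 := by rcases hs with h | h <;> rw [h] <;> norm_num
      convert h (fun i => if i = n then s else ε i) (fun i => by
        split_ifs; exacts [hs, hε i]) using 2
      have hne : ∀ i ∈ Finset.range n, (if i = n then s else ε i) = ε i := fun i hi =>
        if_neg (Finset.mem_range.1 hi).ne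
      have e1 : ∀ i ∈ Finset.range n, ∑ j ∈ Finset.range (n + 1),
          ((if i = n then s else ε i) * (if j = n then s else ε j)) • b i j
          = ∑ j ∈ Finset.range n, (ε i * ε j) • b i j + s • ε i • b i n := by
        intro i hi
        rw [Finset.sum_range_succ, hne i hi, if_pos rfl, smul_smul, mul_comm s]
        congr 1
        exact Finset.sum_congr rfl fun j hj => by rw [hne j hj]
      have e2 : ∑ j ∈ Finset.range (n + 1),
          ((if n = n then s else ε n) * (if j = n then s else ε j)) • b n j
          = s • ∑ j ∈ Finset.range n, ε j • b n j + b n n := by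
        rw [Finset.sum_range_succ, if_pos rfl, hss, one_smul, Finset.smul_sum]
        congr 1
        exact Finset.sum_congr rfl fun j hj => by rw [hne j hj, smul_smul]
      rw [Finset.sum_range_succ, Finset.sum_congr rfl e1, e2, Finset.sum_add_distrib,
        ← Finset.smul_sum, smul_add]
      abel
    have h1 := key 1 (Or.inl rfl)
    have h2 := key (-1) (Or.inr rfl)
    set P := c + b n n + ∑ i ∈ Finset.range n, ∑ j ∈ Finset.range n, (ε i * ε j) • b i j
    set Q := ∑ i ∈ Finset.range n, ε i • b i n + ∑ j ∈ Finset.range n, ε j • b n j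
    have hP : P = (2 : ℝ)⁻¹ • ((P + (1 : ℝ) • Q) + (P + (-1 : ℝ) • Q)) := by
      rw [one_smul, neg_one_smul, show P + Q + (P + -Q) = (2 : ℝ) • P by rw [two_smul]; abel,
        smul_smul]
      norm_num
    rw [hP, norm_smul]
    have := norm_add_le (P + (1 : ℝ) • Q) (P + (-1 : ℝ) • Q)
    have h3 : ‖(2 : ℝ)⁻¹‖ = 2⁻¹ := by norm_num
    rw [h3]
    linarith

variable {Y : Type*} [NormedAddCommGroup Y] [NormedSpace ℝ Y]
  {L R : S →ₗ[ℝ] (Y →L[ℝ] ℝ) →ₗ[ℝ] (Y →L[ℝ] ℝ)} {D : S →ₗ[ℝ] (Y →L[ℝ] ℝ)} {q : ℕ → S}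

/-- A derivation into a dual bimodule, bounded on sign combinations of orthogonal idempotents,
is inner on these idempotents. -/
lemma exists_commutator_on_idempotents
    (hL : ∀ a b v, L (a * b) v = L a (L b v)) (hR : ∀ a b v, R (a * b) v = R b (R a v))
    (hLR : ∀ a b v, L a (R b v) = R b (L a v)) (hD : ∀ a b, D (a * b) = L a (D b) + R b (D a))
    (hq : ∀ i j, q i * q j = if i = j then q i else 0)
    (hLc : ∀ a φ ψ, UltraLim φ ψ → UltraLim (fun n => L a (φ n)) (L a ψ))
    (hRc : ∀ a φ ψ, UltraLim φ ψ → UltraLim (fun n => R a (φ n)) (R a ψ))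
    {K : ℝ}
    (hK : ∀ (n : ℕ) (ε : ℕ → ℝ), (∀ i, ε i = 1 ∨ ε i = -1) →
      ‖L (∑ i ∈ Finset.range n, ε i • q i) (D (∑ i ∈ Finset.range n, ε i • q i))‖ ≤ K)
    (hK' : ∀ n : ℕ, ‖R (∑ i ∈ Finset.range n, q i) (D (∑ i ∈ Finset.range n, q i))‖ ≤ K) :
    ∃ η, ∀ k, D (q k) = L (q k) η - R (q k) η := by
  have hbd : ∀ n, ‖∑ i ∈ Finset.range n, L (q i) (D (q i))
      - R (∑ i ∈ Finset.range n, q i) (D (∑ i ∈ Finset.range n, q i))‖ ≤ K + K := by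
    intro n
    refine (norm_sub_le _ _).trans (add_le_add ?_ (hK' n))
    have := norm_add_diagonal_sum_le (fun i j => L (q i) (D (q j))) K n 0 (fun ε hε => by
      refine (congrArg norm ?_).trans_le (hK n ε hε)
      rw [zero_add, map_sum, map_sum, LinearMap.sum_apply]
      refine Finset.sum_congr rfl fun i _ => ?_
      rw [map_sum]
      refine Finset.sum_congr rfl fun j _ => ?_
      rw [map_smul, map_smul, map_smul, LinearMap.smul_apply, smul_smul, mul_comm])
    simpa using this
  obtain ⟨η, hη⟩ := exists_ultraLim hbd
  refine ⟨η, fun k => ?_⟩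
  refine (UltraLim.of_eventuallyEq (ultraLim_const (D (q k))) ?_).unique
    ((hLc (q k) _ _ hη).sub (hRc (q k) _ _ hη))
  filter_upwards [eventually_gt_atTop k] with n hn
  exact derivation_eq_commutator_on_idempotents hL hR hLR hD hq hn rfl rfl

/-- A derivation vanishing on an approximate identity is determined by its compressions. -/
lemma ultraLim_compression
    (hLR : ∀ a b v, L a (R b v) = R b (L a v)) (hD : ∀ a b, D (a * b) = L a (D b) + R b (D a))
    (hRc : ∀ a φ ψ, UltraLim φ ψ → UltraLim (fun n => R a (φ n)) (R a ψ))
    {e : ℕ → S} (hDe : ∀ n, D (e n) = 0)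
    {K : ℝ} (hK : ∀ n v, ‖L (e n) v‖ ≤ K * ‖v‖)
    (hE : ∀ a v, UltraLim (fun n => L (e n) (L a v)) (L a v))
    (hF : ∀ a v, UltraLim (fun n => R (e n) (R a v)) (R a v))
    (hcol : ∀ a m, UltraLim (fun n => D (e n * (a * e m))) (D (a * e m)))
    (hfact : ∀ c : S, ∃ a b, c = a * b) (a : S) :
    UltraLim (fun n => D (e n * a)) (D a) := by
  have hDl : ∀ n x, D (e n * x) = L (e n) (D x) := fun n x => by rw [hD, hDe, map_zero, add_zero]
  have hDr : ∀ n x, D (x * e n) = R (e n) (D x) := fun n x => by rw [hD, hDe, map_zero, zero_add]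
  obtain ⟨b, c, hbc⟩ := hfact a
  obtain ⟨u, hu⟩ := exists_ultraLim (φ := fun n => L (e n) (D b)) (fun n => hK n (D b))
  have hlim : UltraLim (fun n => L (e n) (D a)) (L b (D c) + R c u) := by
    have h := (hE b (D c)).add (hRc c _ _ hu)
    convert h using 2 with n
    rw [hbc, hD, map_add, hLR]
  have hdiff : D a - (L b (D c) + R c u) = R c (D b - u) := by
    rw [map_sub, hbc, hD]
    abel
  have hzero : ∀ m, R (e m) (D a - (L b (D c) + R c u)) = 0 := by
    intro m
    rw [map_sub, sub_eq_zero]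
    have h1 := hcol a m
    have h2 := hRc (e m) _ _ hlim
    rw [hDr] at h1
    refine h1.unique ?_
    convert h2 using 2 with n
    rw [hDl, hDr, hLR]
  have hfin : D a - (L b (D c) + R c u) = 0 := by
    have h := hF c (D b - u)
    rw [← hdiff] at h
    simp only [hzero] at h
    exact h.unique (ultraLim_const 0)
  rw [← sub_eq_zero.1 hfin] at hlim
  simpa only [hDl] using hlim

end AbstractDerivations

section Domination

variable {Y : Type*} [NormedAddCommGroup Y] [Lattice Y] [HasSolidNorm Y] [IsOrderedAddMonoid Y]
  [NormedSpace ℝ Y]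

lemma norm_le_of_dualLe_zero {f : Y →L[ℝ] ℝ} (hf : dualLe 0 f) {K : ℝ} (hK : 0 ≤ K)
    (h : ∀ y, 0 ≤ y → f y ≤ K * ‖y‖) : ‖f‖ ≤ K := by
  refine f.opNorm_le_bound hK fun y => ?_
  have h1 := dual_mono hf (le_abs_self y)
  have h2 := dual_mono hf (neg_le_abs y)
  have h3 := h |y| (abs_nonneg y)
  rw [norm_abs_eq_norm] at h3
  rw [map_neg] at h2
  exact (abs_le'.2 ⟨h1, h2⟩).trans h3

lemma UltraLim.dualLe_zero {φ : ℕ → (Y →L[ℝ] ℝ)} {ψ : Y →L[ℝ] ℝ} (h : UltraLim φ ψ)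
    (h0 : ∀ n, dualLe 0 (φ n)) : dualLe 0 ψ := fun y hy =>
  ge_of_tendsto' (h y) fun n => h0 n y hy

variable {S : Type*} [NonUnitalRing S] [Module ℝ S]
  {L R : S →ₗ[ℝ] (Y →L[ℝ] ℝ) →ₗ[ℝ] (Y →L[ℝ] ℝ)} {D : S →ₗ[ℝ] (Y →L[ℝ] ℝ)}
  {q : ℕ → S} {u : ℕ → ℕ → S} {c : ℕ → ℕ → S →ₗ[ℝ] ℝ} {P : S → Prop}

/-- A derivation vanishing on the diagonal matrix units of an algebra of matrices, and determined
by its compressions, is dominated by a positive linear map. -/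
lemma exists_positive_majorant
    (hL : ∀ a b v, L (a * b) v = L a (L b v)) (hR : ∀ a b v, R (a * b) v = R b (R a v))
    (hLR : ∀ a b v, L a (R b v) = R b (L a v)) (hD : ∀ a b, D (a * b) = L a (D b) + R b (D a))
    (hq : ∀ i j, q i * q j = if i = j then q i else 0) (hDq : ∀ i, D (q i) = 0)
    (hu : ∀ i j, q i * u i j * q j = u i j)
    (hc : ∀ i j a, q i * a * q j = c i j a • u i j)
    (hLpos : ∀ a, P a → ∀ v, dualLe 0 v → dualLe 0 (L a v))
    (hRpos : ∀ a, P a → ∀ v, dualLe 0 v → dualLe 0 (R a v))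
    (hPq : ∀ i, P (q i)) (hPc : ∀ a, P a → ∀ i j, 0 ≤ c i j a)
    (hPsub : ∀ a, ∃ b b', P b ∧ P b' ∧ a = b - b')
    {e : ℕ → S} (he : ∀ n, e n = ∑ i ∈ Finset.range n, q i)
    {K : ℝ} (hK0 : 0 ≤ K) (hKL : ∀ n v, ‖L (e n) v‖ ≤ K * ‖v‖)
    (hKR : ∀ n v, ‖R (e n) v‖ ≤ K * ‖v‖)
    (hrow : ∀ a, UltraLim (fun n => D (e n * a)) (D a))
    (hcol : ∀ a n, UltraLim (fun m => D (e n * a * e m)) (D (e n * a))) :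
    ∃ Q : S →ₗ[ℝ] (Y →L[ℝ] ℝ), ∀ a, P a → dualLe 0 (Q a) ∧ dualLe (D a) (Q a) := by
  choose mod mod_nonneg le_mod neg_le_mod norm_mod mod_le using
    fun f : Y →L[ℝ] ℝ => exists_dual_modulus f
  have hDcorner : ∀ i j a, D (q i * a * q j) = L (q i) (R (q j) (D a)) := by
    intro i j a
    rw [hD, hDq, map_zero, zero_add, hD, hDq, map_zero, add_zero, hLR]
  have hcorner_pos : ∀ i j v, dualLe 0 v → dualLe 0 (L (q i) (R (q j) v)) := fun i j v hv =>
    hLpos _ (hPq i) _ (hRpos _ (hPq j) _ hv)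
  have hcorner_mono : ∀ i j v v', dualLe v v' →
      dualLe (L (q i) (R (q j) v)) (L (q i) (R (q j) v')) := by
    intro i j v v' h y hy
    have := hcorner_pos i j (v' - v) (fun z hz => by simpa using h z hz) y hy
    simpa using this
  have hcorner_idem : ∀ i j v,
      L (q i) (R (q j) (L (q i) (R (q j) v))) = L (q i) (R (q j) v) := by
    intro i j v
    rw [← hLR, ← hR, ← hL, hq, hq, if_pos rfl, if_pos rfl]
  set w : ℕ → ℕ → (Y →L[ℝ] ℝ) := fun i j => L (q i) (R (q j) (mod (D (u i j)))) with hw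
  have hw0 : ∀ i j, dualLe 0 (w i j) := fun i j => hcorner_pos i j _ (mod_nonneg _)
  have hDw : ∀ i j, dualLe (D (u i j)) (w i j) := by
    intro i j
    have := hcorner_mono i j _ _ (le_mod (D (u i j)))
    rwa [← hDcorner, hu] at this
  have hcw : ∀ a, P a → ∀ i j, dualLe (c i j a • w i j) (L (q i) (R (q j) (mod (D a)))) := by
    intro a ha i j
    set g := L (q i) (R (q j) (mod (D a))) with hg
    have hDa : c i j a • D (u i j) = L (q i) (R (q j) (D a)) := by
      rw [← hDcorner, hc, map_smul]
    have hg1 : dualLe (c i j a • D (u i j)) g := hDa ▸ hcorner_mono i j _ _ (le_mod (D a))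
    have hg2 : dualLe (-(c i j a • D (u i j))) g := by
      rw [hDa, ← map_neg, ← map_neg]
      exact hcorner_mono i j _ _ (neg_le_mod (D a))
    rcases (hPc a ha i j).eq_or_lt with h0 | h0
    · rw [← h0, zero_smul]
      exact hcorner_pos i j _ (mod_nonneg _)
    · have h1 : dualLe (mod (D (u i j))) ((c i j a)⁻¹ • g) := by
        refine mod_le _ _ (fun y hy => ?_) (fun y hy => ?_)
        · have := hg1 y hy
          simp only [smul_apply, smul_eq_mul] at this ⊢
          rwa [inv_mul_eq_div, le_div_iff₀' h0]
        · have := hg2 y hy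
          simp only [smul_apply, neg_apply, smul_eq_mul] at this ⊢
          rw [inv_mul_eq_div, le_div_iff₀' h0]
          linarith
      have h2 := hcorner_mono i j _ _ h1
      rw [map_smul, map_smul, hg, hcorner_idem, ← hg] at h2
      intro y hy
      have := h2 y hy
      simp only [smul_apply, smul_eq_mul] at this ⊢
      rwa [inv_mul_eq_div, le_div_iff₀' h0] at this
  set p : ℕ → S → (Y →L[ℝ] ℝ) := fun n a =>
    ∑ i ∈ Finset.range n, ∑ j ∈ Finset.range n, c i j a • w i j with hp
  have happ : ∀ n m a y, (∑ i ∈ Finset.range n, ∑ j ∈ Finset.range m, c i j a • w i j) y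
      = ∑ i ∈ Finset.range n, ∑ j ∈ Finset.range m, c i j a * w i j y := by
    intro n m a y
    simp
  have hterm : ∀ a, P a → ∀ y, 0 ≤ y → ∀ i j, 0 ≤ c i j a * w i j y := fun a ha y hy i j =>
    mul_nonneg (hPc a ha i j) (hw0 i j y hy)
  have hp0 : ∀ a, P a → ∀ n, dualLe 0 (p n a) := by
    intro a ha n y hy
    rw [hp, happ]
    exact Finset.sum_nonneg fun i _ => Finset.sum_nonneg fun j _ => hterm a ha y hy i j
  have hpbd : ∀ a, P a → ∀ n, ‖p n a‖ ≤ K * (K * ‖mod (D a)‖) := by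
    intro a ha n
    refine norm_le_of_dualLe_zero (hp0 a ha n) (by positivity) fun y hy => ?_
    have h1 : p n a y ≤ L (e n) (R (e n) (mod (D a))) y := by
      rw [hp, happ, he, map_sum, LinearMap.sum_apply, sum_apply]
      refine Finset.sum_le_sum fun i _ => ?_
      rw [map_sum, LinearMap.sum_apply, map_sum, sum_apply]
      refine Finset.sum_le_sum fun j _ => ?_
      simpa using hcw a ha i j y hy
    refine h1.trans ((Real.le_norm_self _).trans ((ContinuousLinearMap.le_opNorm _ y).trans ?_))
    refine mul_le_mul_of_nonneg_right ?_ (norm_nonneg y)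
    exact (hKL n _).trans (mul_le_mul_of_nonneg_left (hKR n _) hK0)
  have hp_add : ∀ n a b, p n (a + b) = p n a + p n b := by
    intro n a b
    simp only [hp, map_add, add_smul, Finset.sum_add_distrib]
  have hp_sub : ∀ n a b, p n (a - b) = p n a - p n b := fun n a b =>
    eq_sub_of_add_eq (by rw [← hp_add, sub_add_cancel])
  have hp_smul : ∀ n (r : ℝ) a, p n (r • a) = r • p n a := by
    intro n r a
    simp only [hp, map_smul, smul_eq_mul, mul_smul, Finset.smul_sum]
  have hex : ∀ a, ∃ ψ, UltraLim (fun n => p n a) ψ := by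
    intro a
    obtain ⟨b, b', hb, hb', rfl⟩ := hPsub a
    refine exists_ultraLim (K := K * (K * ‖mod (D b)‖) + K * (K * ‖mod (D b')‖)) fun n => ?_
    rw [hp_sub]
    exact (norm_sub_le _ _).trans (add_le_add (hpbd b hb n) (hpbd b' hb' n))
  choose Q hQ using hex
  refine ⟨{ toFun := Q, map_add' := fun a b => ?_, map_smul' := fun r a => ?_ },
    fun a ha => ⟨(hQ a).dualLe_zero (hp0 a ha), fun y hy => ?_⟩⟩
  · refine (hQ (a + b)).unique ?_
    simpa only [hp_add] using (hQ a).add (hQ b)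
  · refine (hQ (r • a)).unique ?_
    simpa only [hp_smul, RingHom.id_apply] using (hQ a).const_smul r
  · change D a y ≤ Q a y
    refine le_of_tendsto' (hrow a y) fun n => le_of_tendsto' (hcol a n y) fun m => ?_
    refine ge_of_tendsto (hQ a y) (Filter.Eventually.filter_mono Nat.hyperfilter_le_atTop ?_)
    filter_upwards [eventually_ge_atTop n, eventually_ge_atTop m] with N hn hm
    have hexp : e n * a * e m
        = ∑ i ∈ Finset.range n, ∑ j ∈ Finset.range m, c i j a • u i j := by
      rw [he, he, Finset.sum_mul, Finset.sum_mul]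
      refine Finset.sum_congr rfl fun i _ => ?_
      rw [Finset.mul_sum]
      exact Finset.sum_congr rfl fun j _ => hc i j a
    calc D (e n * a * e m) y
        = ∑ i ∈ Finset.range n, ∑ j ∈ Finset.range m, c i j a * D (u i j) y := by
          rw [hexp]
          simp
      _ ≤ ∑ i ∈ Finset.range n, ∑ j ∈ Finset.range m, c i j a * w i j y :=
          Finset.sum_le_sum fun i _ => Finset.sum_le_sum fun j _ =>
            mul_le_mul_of_nonneg_left (hDw i j y hy) (hPc a ha i j)
      _ ≤ ∑ i ∈ Finset.range n, ∑ j ∈ Finset.range N, c i j a * w i j y :=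
          Finset.sum_le_sum fun i _ => Finset.sum_le_sum_of_subset_of_nonneg
            (Finset.range_mono hm) fun j _ _ => hterm a ha y hy i j
      _ ≤ ∑ i ∈ Finset.range N, ∑ j ∈ Finset.range N, c i j a * w i j y :=
          Finset.sum_le_sum_of_subset_of_nonneg (Finset.range_mono hn) fun i _ _ =>
            Finset.sum_nonneg fun j _ => hterm a ha y hy i j
      _ = p N a y := (happ N N a y).symm

end Domination

section AtomicBasis

variable {X : Type*} [NormedAddCommGroup X] [Lattice X] [HasSolidNorm X] [IsOrderedAddMonoid X]
  [NormedSpace ℝ X]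

lemma lattice_abs_sum_le {ι : Type*} (s : Finset ι) (f : ι → X) :
    |∑ i ∈ s, f i| ≤ ∑ i ∈ s, |f i| :=
  Finset.le_sum_of_subadditive (fun y : X => |y|) abs_zero.le abs_add_le s f

lemma rnorm_nonneg (T : X →L[ℝ] X) : 0 ≤ rnorm T :=
  Real.sInf_nonneg (by rintro _ ⟨S, rfl, -⟩; exact norm_nonneg S)

lemma rnorm_le {T S : X →L[ℝ] X} (h : ∀ y, |T y| ≤ S |y|) : rnorm T ≤ ‖S‖ :=
  csInf_le ⟨0, by rintro _ ⟨S, rfl, -⟩; exact norm_nonneg S⟩ ⟨S, rfl, h⟩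

lemma abs_apply_le_apply_abs {l g : X →L[ℝ] ℝ} (h1 : dualLe l g) (h2 : dualLe (-l) g) (y : X) :
    |l y| ≤ g |y| := by
  have a1 := h1 _ (posPart_nonneg y)
  have a2 := h1 _ (negPart_nonneg y)
  have b1 := h2 _ (posPart_nonneg y)
  have b2 := h2 _ (negPart_nonneg y)
  simp only [neg_apply] at b1 b2
  have e1 : l y = l y⁺ - l y⁻ := by rw [← map_sub, posPart_sub_negPart]
  have e2 : g |y| = g y⁺ + g y⁻ := by rw [← map_add, posPart_add_negPart]
  rw [e1, e2, abs_le]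
  constructor <;> linarith

/-- The regular norm of a rank-one operator is at most the product of the norms. -/
lemma rnorm_smulRight_le (l : X →L[ℝ] ℝ) (z : X) : rnorm (l.smulRight z) ≤ ‖l‖ * ‖z‖ := by
  obtain ⟨g, -, h1, h2, hg, -⟩ := exists_dual_modulus l
  have h : ∀ y, |(l.smulRight z) y| ≤ (g.smulRight |z|) |y| := fun y => by
    simp only [ContinuousLinearMap.smulRight_apply]
    exact (solid_abs_smul_le _ _).trans
      (solid_smul_le_smul_right (abs_apply_le_apply_abs h1 h2 y) (abs_nonneg z))
  refine (rnorm_le h).trans ?_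
  rw [ContinuousLinearMap.norm_smulRight_apply, norm_abs_eq_norm]
  exact mul_le_mul_of_nonneg_right hg (norm_nonneg z)

variable {x : ℕ → X} {xs : ℕ → X →L[ℝ] ℝ}

lemma inf_smul_eq_zero_of_inf_eq_zero {a b : X} (ha : 0 ≤ a) (hb : 0 ≤ b) (h : a ⊓ b = 0) {r : ℝ}
    (hr : 0 ≤ r) : a ⊓ r • b = 0 := by
  have hs : 0 < max r 1 := lt_max_of_lt_right one_pos
  refine le_antisymm ?_ (le_inf ha (solid_smul_nonneg hr hb))
  have h1 : (max r 1)⁻¹ • (a ⊓ r • b) ≤ a ⊓ b := by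
    refine le_inf ?_ ?_
    · refine (solid_smul_le_smul_left (by positivity) inf_le_left).trans ?_
      have := solid_smul_le_smul_right (inv_le_one_of_one_le₀ (le_max_right r 1)) ha
      rwa [one_smul] at this
    · refine (solid_smul_le_smul_left (by positivity)
        (inf_le_right.trans (solid_smul_le_smul_right (le_max_left r 1) hb))).trans ?_
      rw [smul_smul, inv_mul_cancel₀ hs.ne', one_smul]
  rw [h] at h1
  have h2 := solid_smul_le_smul_left hs.le h1
  rwa [smul_smul, mul_inv_cancel₀ hs.ne', one_smul, smul_zero] at h2

lemma inf_add_eq_zero {a b c : X} (ha : 0 ≤ a) (hb : 0 ≤ b) (hc : 0 ≤ c) (hab : a ⊓ b = 0)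
    (hac : a ⊓ c = 0) : a ⊓ (b + c) = 0 := by
  refine le_antisymm ?_ (le_inf ha (add_nonneg hb hc))
  have h : a ⊓ (b + c) ≤ a ⊓ b + a ⊓ c := by
    rw [add_inf]
    refine le_inf (inf_le_left.trans ?_) ?_
    · exact le_add_of_nonneg_left (le_inf ha hb)
    · rw [inf_add]
      exact le_inf (inf_le_left.trans (le_add_of_nonneg_right hc)) inf_le_right
  simpa [hab, hac] using h

lemma inf_sum_eq_zero {ι : Type*} (s : Finset ι) {a : X} (ha : 0 ≤ a) (b : ι → X)
    (hb : ∀ i ∈ s, 0 ≤ b i) (h : ∀ i ∈ s, a ⊓ b i = 0) : a ⊓ ∑ i ∈ s, b i = 0 := by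
  classical
  induction s using Finset.induction_on with
  | empty => simpa using ha
  | insert i s his ih =>
    rw [Finset.sum_insert his]
    refine inf_add_eq_zero ha (hb i (Finset.mem_insert_self i s))
      (Finset.sum_nonneg fun j hj => hb j (Finset.mem_insert_of_mem hj))
      (h i (Finset.mem_insert_self i s)) (ih (fun j hj => hb j (Finset.mem_insert_of_mem hj))
        fun j hj => h j (Finset.mem_insert_of_mem hj))

lemma atom_inf_eq_zero (hx : ∀ i, IsNormAtom (x i))
    (hbi : ∀ i j, xs i (x j) = if i = j then (1 : ℝ) else 0) {i j : ℕ} (hij : i ≠ j) :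
    x i ⊓ x j = 0 := by
  have h0 : 0 ≤ x i ⊓ x j := le_inf (hx i).1.le (hx j).1.le
  obtain ⟨r, hr⟩ := (hx i).2.2 _ h0 inf_le_left
  obtain ⟨s, hs⟩ := (hx j).2.2 _ h0 inf_le_right
  have h1 : xs i (r • x i) = xs i (s • x j) := by rw [← hr, hs]
  rw [map_smul, map_smul, hbi, hbi, if_pos rfl, if_neg hij, smul_eq_mul, smul_eq_mul, mul_one,
    mul_zero] at h1
  rw [hr, h1, zero_smul]

/-- The biorthogonal functionals of a basis of atoms are positive. -/
lemma coord_nonneg (hx : ∀ i, IsNormAtom (x i))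
    (hbi : ∀ i j, xs i (x j) = if i = j then (1 : ℝ) else 0)
    (hbasis : ∀ y : X, Tendsto (fun n => ∑ i ∈ Finset.range n, xs i y • x i) atTop (𝓝 y))
    (i : ℕ) {y : X} (hy : 0 ≤ y) : 0 ≤ xs i y := by
  by_contra! hneg
  set t := -xs i y with ht
  have htpos : 0 < t := by linarith
  have hxi := (hx i).1.le
  have hlim : Tendsto (fun n => x i ⊓ |∑ k ∈ Finset.range n, xs k y • x k + t • x i|) atTop
      (𝓝 (x i ⊓ |y + t • x i|)) :=
    tendsto_const_nhds.inf_nhds (((hbasis y).add_const _).sup_nhds ((hbasis y).add_const _).neg)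
  have hzero : ∀ᶠ n in atTop, x i ⊓ |∑ k ∈ Finset.range n, xs k y • x k + t • x i| = 0 := by
    filter_upwards [eventually_gt_atTop i] with n hn
    have hsplit : ∑ k ∈ Finset.range n, xs k y • x k + t • x i
        = ∑ k ∈ (Finset.range n).erase i, xs k y • x k := by
      rw [← Finset.add_sum_erase _ _ (Finset.mem_range.2 hn), ht, neg_smul]
      abel
    rw [hsplit]
    refine le_antisymm ?_ (le_inf hxi (abs_nonneg _))
    have hpos : ∀ k ∈ (Finset.range n).erase i, 0 ≤ |xs k y| • x k := fun k _ =>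
      solid_smul_nonneg (abs_nonneg _) (hx k).1.le
    rw [← inf_sum_eq_zero ((Finset.range n).erase i) hxi (fun k => |xs k y| • x k) hpos
      fun k hk => inf_smul_eq_zero_of_inf_eq_zero hxi (hx k).1.le
        (atom_inf_eq_zero hx hbi (Finset.ne_of_mem_erase hk).symm) (abs_nonneg _)]
    refine inf_le_inf_left _ ((lattice_abs_sum_le _ _).trans ?_)
    refine Finset.sum_le_sum fun k _ => ?_
    have := solid_abs_smul_le (xs k y) (x k)
    rwa [abs_of_nonneg (hx k).1.le] at this
  have hinf : x i ⊓ |y + t • x i| = 0 :=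
    tendsto_nhds_unique hlim ((tendsto_congr' hzero).2 tendsto_const_nhds)
  have hle : min 1 t • x i ≤ x i ⊓ |y + t • x i| := by
    refine le_inf ?_ ?_
    · have := solid_smul_le_smul_right (min_le_left 1 t) hxi
      rwa [one_smul] at this
    · refine (solid_smul_le_smul_right (min_le_right 1 t) hxi).trans ?_
      exact (le_add_of_nonneg_left hy).trans (le_abs_self _)
  rw [hinf] at hle
  have hm : 0 < min 1 t := lt_min one_pos htpos
  have h2 := solid_smul_le_smul_left (inv_nonneg.2 hm.le) hle
  rw [smul_smul, inv_mul_cancel₀ hm.ne', one_smul, smul_zero] at h2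
  exact (hx i).1.not_ge h2

lemma partial_sum_le (hx : ∀ i, IsNormAtom (x i))
    (hbi : ∀ i j, xs i (x j) = if i = j then (1 : ℝ) else 0)
    (hbasis : ∀ y : X, Tendsto (fun n => ∑ i ∈ Finset.range n, xs i y • x i) atTop (𝓝 y))
    (n : ℕ) {y : X} (hy : 0 ≤ y) : ∑ i ∈ Finset.range n, xs i y • x i ≤ y := by
  refine ge_of_tendsto (hbasis y) ?_
  filter_upwards [eventually_ge_atTop n] with m hm
  exact Finset.sum_le_sum_of_subset_of_nonneg (Finset.range_mono hm) fun i _ _ =>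
    solid_smul_nonneg (coord_nonneg hx hbi hbasis i hy) (hx i).1.le

/-- Diagonal sign operators have regular norm at most one. -/
lemma rnorm_sign_sum_le_one (hx : ∀ i, IsNormAtom (x i))
    (hbi : ∀ i j, xs i (x j) = if i = j then (1 : ℝ) else 0)
    (hbasis : ∀ y : X, Tendsto (fun n => ∑ i ∈ Finset.range n, xs i y • x i) atTop (𝓝 y))
    (n : ℕ) (ε : ℕ → ℝ) (hε : ∀ i, ε i = 1 ∨ ε i = -1) :
    rnorm (∑ i ∈ Finset.range n, ε i • (xs i).smulRight (x i)) ≤ 1 := by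
  refine (rnorm_le (S := ContinuousLinearMap.id ℝ X) fun y => ?_).trans
    ContinuousLinearMap.norm_id_le
  refine le_trans ?_ (partial_sum_le hx hbi hbasis n (abs_nonneg y))
  rw [sum_apply]
  refine (lattice_abs_sum_le _ _).trans (Finset.sum_le_sum fun i _ => ?_)
  rw [smul_apply, ContinuousLinearMap.smulRight_apply, smul_smul]
  refine (solid_abs_smul_le _ _).trans ?_
  rw [abs_of_nonneg (hx i).1.le]
  refine solid_smul_le_smul_right ?_ (hx i).1.le
  have h1 : |ε i| = 1 := by rcases hε i with h | h <;> rw [h] <;> norm_num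
  rw [abs_mul, h1, one_mul]
  refine abs_apply_le_apply_abs (fun z _ => le_rfl) (fun z hz => ?_) y
  have := coord_nonneg hx hbi hbasis i hz
  simp only [neg_apply]
  linarith

end AtomicBasis

section UltraLimits

variable {Y : Type*} [NormedAddCommGroup Y] [NormedSpace ℝ Y]

lemma UltraLim.sum {ι : Type*} {φ : ι → ℕ → (Y →L[ℝ] ℝ)} {ψ : ι → (Y →L[ℝ] ℝ)} (s : Finset ι)
    (h : ∀ i ∈ s, UltraLim (φ i) (ψ i)) :
    UltraLim (fun n => ∑ i ∈ s, φ i n) (∑ i ∈ s, ψ i) := fun y => by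
  simpa only [sum_apply] using tendsto_finsetSum s fun i hi => h i hi y

variable [Lattice Y] [HasSolidNorm Y] [IsOrderedAddMonoid Y]

lemma dualLe_antisymm {f g : Y →L[ℝ] ℝ} (h : dualLe f g) (h' : dualLe g f) : f = g := by
  have key : ∀ y, 0 ≤ y → f y = g y := fun y hy => le_antisymm (h y hy) (h' y hy)
  ext y
  rw [← posPart_sub_negPart y, map_sub, map_sub, key _ (posPart_nonneg y),
    key _ (negPart_nonneg y)]

lemma ultraLim_of_dualIsLUB {φ : ℕ → (Y →L[ℝ] ℝ)} {ψ : Y →L[ℝ] ℝ}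
    (hmono : ∀ m n, m ≤ n → dualLe (φ m) (φ n)) {K : ℝ} (hK : ∀ n, ‖φ n‖ ≤ K)
    (h : dualIsLUB (Set.range φ) ψ) : UltraLim φ ψ := by
  obtain ⟨ψ', hψ'⟩ := exists_ultraLim hK
  have h1 : dualLe ψ ψ' := by
    refine h.2 _ ?_
    rintro _ ⟨m, rfl⟩ y hy
    refine ge_of_tendsto (hψ' y) (Filter.Eventually.filter_mono Nat.hyperfilter_le_atTop ?_)
    filter_upwards [eventually_ge_atTop m] with n hn
    exact hmono m n hn y hy
  have h2 : dualLe ψ' ψ := fun y hy =>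
    le_of_tendsto' (hψ' y) fun n => h.1 _ ⟨n, rfl⟩ y hy
  rwa [dualLe_antisymm h1 h2]

/-- A property of functionals stable under differences holds for all functionals once it holds
for the positive ones. -/
lemma dual_induction_of_nonneg {p : (Y →L[ℝ] ℝ) → Prop} (hsub : ∀ f g, p f → p g → p (f - g))
    (hpos : ∀ f, dualLe 0 f → p f) (f : Y →L[ℝ] ℝ) : p f := by
  obtain ⟨g, hg, hfg, -⟩ := exists_dual_modulus f
  have h := hsub g (g - f) (hpos g hg) (hpos (g - f) fun y hy => by simpa using hfg y hy)
  rwa [sub_sub_cancel] at h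

end UltraLimits

section OperatorAlgebra

variable {X Y : Type*} [NormedAddCommGroup X] [Lattice X] [HasSolidNorm X] [IsOrderedAddMonoid X]
  [NormedSpace ℝ X] [NormedAddCommGroup Y] [Lattice Y] [HasSolidNorm Y] [IsOrderedAddMonoid Y]
  [NormedSpace ℝ Y]
  {x : ℕ → X} {xs : ℕ → X →L[ℝ] ℝ} {S : NonUnitalSubalgebra ℝ (X →L[ℝ] X)}

/-- If each left-truncated product converges on positive data, it converges on all data. -/
lemma ultraLim_of_dualIsLUB_module {T B : S →ₗ[ℝ] (Y →L[ℝ] ℝ) →ₗ[ℝ] (Y →L[ℝ] ℝ)} {e : ℕ → S}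
    (hTpos : ∀ a : S, IsPosOp (a : X →L[ℝ] X) → ∀ v, dualLe 0 v → dualLe 0 (T a v))
    (hBpos : ∀ a : S, IsPosOp (a : X →L[ℝ] X) → ∀ v, dualLe 0 v → dualLe 0 (B a v))
    (he : ∀ m n, m ≤ n → IsPosOp ((e n - e m : S) : X →L[ℝ] X))
    {K : ℝ} (hK : ∀ n v, ‖T (e n) v‖ ≤ K * ‖v‖)
    (hPsub : ∀ a : S, ∃ b b' : S, IsPosOp (b : X →L[ℝ] X) ∧ IsPosOp (b' : X →L[ℝ] X) ∧ a = b - b')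
    (hlub : ∀ a : S, IsPosOp (a : X →L[ℝ] X) → ∀ v, dualLe 0 v →
      dualIsLUB (Set.range fun n => T (e n) (B a v)) (B a v)) (a : S) (v : Y →L[ℝ] ℝ) :
    UltraLim (fun n => T (e n) (B a v)) (B a v) := by
  have key : ∀ a : S, IsPosOp (a : X →L[ℝ] X) → ∀ v,
      UltraLim (fun n => T (e n) (B a v)) (B a v) := by
    intro a ha
    refine dual_induction_of_nonneg (fun f g hf hg => ?_) fun v hv => ?_
    · simpa only [map_sub] using hf.sub hg
    · refine ultraLim_of_dualIsLUB (fun m n hmn y hy => ?_) (fun n => hK n _) (hlub a ha v hv)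
      have := hTpos _ (he m n hmn) _ (hBpos a ha v hv) y hy
      simpa using this
  obtain ⟨b, b', hb, hb', rfl⟩ := hPsub a
  simpa only [map_sub, LinearMap.sub_apply] using (key b hb v).sub (key b' hb' v)

lemma isPosOp_smulRight_of_atoms (hx : ∀ i, IsNormAtom (x i))
    (hbi : ∀ i j, xs i (x j) = if i = j then (1 : ℝ) else 0)
    (hbasis : ∀ y : X, Tendsto (fun n => ∑ i ∈ Finset.range n, xs i y • x i) atTop (𝓝 y))
    (i j : ℕ) : IsPosOp ((xs i).smulRight (x j)) := fun _ hy =>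
  solid_smul_nonneg (coord_nonneg hx hbi hbasis i hy) (hx j).1.le

variable {D : S →ₗ[ℝ] (Y →L[ℝ] ℝ)} {q : ℕ → S} {C : ℝ}

/-- A bounded linear map is determined on columns by truncations of the columns. -/
lemma ultraLim_column_truncation (hq : ∀ i, (q i : X →L[ℝ] X) = (xs i).smulRight (x i))
    (hbasis : ∀ y : X, Tendsto (fun n => ∑ i ∈ Finset.range n, xs i y • x i) atTop (𝓝 y))
    (hC : 0 ≤ C) (hD : ∀ a : S, ‖D a‖ ≤ C * rnorm (a : X →L[ℝ] X)) (a : S) (j : ℕ) :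
    UltraLim (fun n => D ((∑ i ∈ Finset.range n, q i) * (a * q j))) (D (a * q j)) := by
  refine ultraLim_of_tendsto_norm ?_
  set z := (a : X →L[ℝ] X) (x j) with hz
  have hlim : Tendsto (fun n => C * (‖xs j‖ * ‖z - ∑ i ∈ Finset.range n, xs i z • x i‖)) atTop
      (𝓝 0) := by
    have := ((hbasis z).const_sub z).norm.const_mul ‖xs j‖ |>.const_mul C
    simpa using this
  refine squeeze_zero (fun _ => norm_nonneg _) (fun n => ?_) hlim
  rw [← map_sub]
  refine (hD _).trans (mul_le_mul_of_nonneg_left ?_ hC)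
  refine (congrArg rnorm ?_).trans_le
    (rnorm_smulRight_le (xs j) (z - ∑ i ∈ Finset.range n, xs i z • x i))
  ext y
  simp [hq, hz, smul_sub, Finset.smul_sum, sum_apply, smul_smul]

/-- A bounded linear map is determined on rows by truncations of the rows. -/
lemma ultraLim_row_truncation (hq : ∀ i, (q i : X →L[ℝ] X) = (xs i).smulRight (x i))
    (hshrink : ∀ l : X →L[ℝ] ℝ,
      Tendsto (fun n => ‖l - ∑ i ∈ Finset.range n, l (x i) • xs i‖) atTop (𝓝 0))
    (hC : 0 ≤ C) (hD : ∀ a : S, ‖D a‖ ≤ C * rnorm (a : X →L[ℝ] X)) (a : S) (i : ℕ) :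
    UltraLim (fun m => D (q i * a * ∑ k ∈ Finset.range m, q k)) (D (q i * a)) := by
  refine ultraLim_of_tendsto_norm ?_
  set l := xs i ∘L (a : X →L[ℝ] X) with hl
  have hlim : Tendsto (fun n => C * (‖l - ∑ k ∈ Finset.range n, l (x k) • xs k‖ * ‖x i‖)) atTop
      (𝓝 0) := by
    have := ((hshrink l).mul_const ‖x i‖).const_mul C
    simpa using this
  refine squeeze_zero (fun _ => norm_nonneg _) (fun n => ?_) hlim
  rw [← map_sub]
  refine (hD _).trans (mul_le_mul_of_nonneg_left ?_ hC)
  refine (congrArg rnorm ?_).trans_le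
    (rnorm_smulRight_le (l - ∑ k ∈ Finset.range n, l (x k) • xs k) (x i))
  ext y
  simp [hq, hl, sub_smul, Finset.sum_smul, sum_apply, smul_smul, mul_comm]

/-- A bounded derivation from an algebra of regular operators on an atomic Banach lattice into a
dual Banach lattice module is the difference of two positive linear maps. -/
theorem derivation_eq_sub_of_positive
    {L R : S →ₗ[ℝ] (Y →L[ℝ] ℝ) →ₗ[ℝ] (Y →L[ℝ] ℝ)} {M : ℝ}
    (hx : ∀ i, IsNormAtom (x i))
    (hbi : ∀ i j, xs i (x j) = if i = j then (1 : ℝ) else 0)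
    (hbasis : ∀ y : X, Tendsto (fun n => ∑ i ∈ Finset.range n, xs i y • x i) atTop (𝓝 y))
    (hshrink : ∀ l : X →L[ℝ] ℝ,
      Tendsto (fun n => ‖l - ∑ i ∈ Finset.range n, l (x i) • xs i‖) atTop (𝓝 0))
    (hS : ∀ i j, (xs j).smulRight (x i) ∈ S)
    (hL : ∀ a b v, L (a * b) v = L a (L b v)) (hR : ∀ a b v, R (a * b) v = R b (R a v))
    (hLR : ∀ a b v, L a (R b v) = R b (L a v)) (hD : ∀ a b, D (a * b) = L a (D b) + R b (D a))
    (hLc : ∀ a φ ψ, UltraLim φ ψ → UltraLim (fun n => L a (φ n)) (L a ψ))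
    (hRc : ∀ a φ ψ, UltraLim φ ψ → UltraLim (fun n => R a (φ n)) (R a ψ))
    (hLpos : ∀ a : S, IsPosOp (a : X →L[ℝ] X) → ∀ v, dualLe 0 v → dualLe 0 (L a v))
    (hRpos : ∀ a : S, IsPosOp (a : X →L[ℝ] X) → ∀ v, dualLe 0 v → dualLe 0 (R a v))
    (hM : 0 ≤ M) (hLbd : ∀ (a : S) v, ‖L a v‖ ≤ M * rnorm (a : X →L[ℝ] X) * ‖v‖)
    (hRbd : ∀ (a : S) v, ‖R a v‖ ≤ M * rnorm (a : X →L[ℝ] X) * ‖v‖)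
    (hC : 0 ≤ C) (hDbd : ∀ a : S, ‖D a‖ ≤ C * rnorm (a : X →L[ℝ] X))
    (hPsub : ∀ a : S, ∃ b b' : S, IsPosOp (b : X →L[ℝ] X) ∧ IsPosOp (b' : X →L[ℝ] X) ∧ a = b - b')
    {e : ℕ → S} (he : ∀ n, e n = ∑ i ∈ Finset.range n, ⟨(xs i).smulRight (x i), hS i i⟩)
    (hE : ∀ a : S, IsPosOp (a : X →L[ℝ] X) → ∀ v, dualLe 0 v →
      dualIsLUB (Set.range fun n => L (e n) (L a v)) (L a v))
    (hF : ∀ a : S, IsPosOp (a : X →L[ℝ] X) → ∀ v, dualLe 0 v →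
      dualIsLUB (Set.range fun n => R (e n) (R a v)) (R a v))
    (hfact : ∀ c : S, ∃ a b, c = a * b) :
    ∃ Q₁ Q₂ : S →ₗ[ℝ] (Y →L[ℝ] ℝ), D = Q₁ - Q₂ ∧
      ∀ a : S, IsPosOp (a : X →L[ℝ] X) → dualLe 0 (Q₁ a) ∧ dualLe 0 (Q₂ a) := by
  set q : ℕ → S := fun i => ⟨(xs i).smulRight (x i), hS i i⟩ with hqdef
  have hqcoe : ∀ i, (q i : X →L[ℝ] X) = (xs i).smulRight (x i) := fun i => rfl
  have he' : ∀ n, e n = ∑ i ∈ Finset.range n, q i := he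
  have hq : ∀ i j, q i * q j = if i = j then q i else 0 := by
    intro i j
    ext y
    split_ifs with h
    · subst h
      simp [hqcoe, hbi]
    · simp [hqcoe, hbi, h]
  have hPq : ∀ i, IsPosOp (q i : X →L[ℝ] X) := fun i =>
    isPosOp_smulRight_of_atoms hx hbi hbasis i i
  have hsign : ∀ (n : ℕ) (ε : ℕ → ℝ), (∀ i, ε i = 1 ∨ ε i = -1) →
      rnorm ((∑ i ∈ Finset.range n, ε i • q i : S) : X →L[ℝ] X) ≤ 1 := by
    intro n ε hε
    convert rnorm_sign_sum_le_one hx hbi hbasis n ε hε using 2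
    simp [hqcoe]
  have hsum : ∀ n, rnorm ((∑ i ∈ Finset.range n, q i : S) : X →L[ℝ] X) ≤ 1 := by
    intro n
    simpa using hsign n (fun _ => 1) fun _ => Or.inl rfl
  have hKT : ∀ T : S →ₗ[ℝ] (Y →L[ℝ] ℝ) →ₗ[ℝ] (Y →L[ℝ] ℝ),
      (∀ (a : S) v, ‖T a v‖ ≤ M * rnorm (a : X →L[ℝ] X) * ‖v‖) →
      ∀ a : S, rnorm (a : X →L[ℝ] X) ≤ 1 → ∀ v, ‖T a v‖ ≤ M * ‖v‖ := fun T hT a ha v =>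
    (hT a v).trans (mul_le_mul_of_nonneg_right (mul_le_of_le_one_right hM ha) (norm_nonneg v))
  have hKD : ∀ a : S, rnorm (a : X →L[ℝ] X) ≤ 1 → ‖D a‖ ≤ C := fun a ha =>
    (hDbd a).trans (mul_le_of_le_one_right hC ha)
  have hKL : ∀ n v, ‖L (e n) v‖ ≤ M * ‖v‖ := fun n => hKT L hLbd _ (he' n ▸ hsum n)
  have hKR : ∀ n v, ‖R (e n) v‖ ≤ M * ‖v‖ := fun n => hKT R hRbd _ (he' n ▸ hsum n)
  obtain ⟨η, hη⟩ := exists_commutator_on_idempotents hL hR hLR hD hq hLc hRc (K := M * C)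
    (fun n ε hε => (hKT L hLbd _ (hsign n ε hε) _).trans
      (mul_le_mul_of_nonneg_left (hKD _ (hsign n ε hε)) hM))
    (fun n => (hKT R hRbd _ (hsum n) _).trans (mul_le_mul_of_nonneg_left (hKD _ (hsum n)) hM))
  set D' : S →ₗ[ℝ] (Y →L[ℝ] ℝ) := D - L.flip η + R.flip η with hD'def
  have hD'apply : ∀ a, D' a = D a - L a η + R a η := fun a => by simp [hD'def]
  have hD' : ∀ a b, D' (a * b) = L a (D' b) + R b (D' a) := by
    intro a b
    simp only [hD'apply, hD, hL, hR, map_add, map_sub, hLR]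
    abel
  have hD'q : ∀ i, D' (q i) = 0 := fun i => by
    rw [hD'apply, hη]
    abel
  have hC' : 0 ≤ C + 2 * M * ‖η‖ := by positivity
  have hD'bd : ∀ a : S, ‖D' a‖ ≤ (C + 2 * M * ‖η‖) * rnorm (a : X →L[ℝ] X) := by
    intro a
    rw [hD'apply]
    have h1 := norm_add_le (D a - L a η) (R a η)
    have h2 := norm_sub_le (D a) (L a η)
    have h3 := hDbd a
    have h4 := hLbd a η
    have h5 := hRbd a η
    linarith
  have he_mono : ∀ m n, m ≤ n → IsPosOp ((e n - e m : S) : X →L[ℝ] X) := by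
    intro m n hmn y hy
    have h1 : e n - e m = ∑ i ∈ Finset.Ico m n, q i := by
      rw [he', he', Finset.sum_Ico_eq_sub _ hmn]
    rw [h1, AddSubmonoidClass.coe_finsetSum, sum_apply]
    exact Finset.sum_nonneg fun i _ => hPq i y hy
  have hrow : ∀ a, UltraLim (fun n => D' (e n * a)) (D' a) := by
    refine ultraLim_compression hLR hD' hRc (fun n => ?_) hKL
      (ultraLim_of_dualIsLUB_module hLpos hLpos he_mono hKL hPsub hE)
      (ultraLim_of_dualIsLUB_module hRpos hRpos he_mono hKR hPsub hF) (fun a m => ?_) hfact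
    · rw [he', map_sum]
      exact Finset.sum_eq_zero fun i _ => hD'q i
    · have := UltraLim.sum (Finset.range m) fun j _ =>
        ultraLim_column_truncation hqcoe hbasis hC' hD'bd a j
      simpa only [he', Finset.mul_sum, map_sum] using this
  have hcol : ∀ a n, UltraLim (fun m => D' (e n * a * e m)) (D' (e n * a)) := by
    intro a n
    have := UltraLim.sum (Finset.range n) fun i _ =>
      ultraLim_row_truncation hqcoe hshrink hC' hD'bd a i
    simpa only [he', Finset.sum_mul, map_sum] using this
  set u : ℕ → ℕ → S := fun i j => ⟨(xs j).smulRight (x i), hS i j⟩ with hudef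
  set c : ℕ → ℕ → S →ₗ[ℝ] ℝ := fun i j =>
    { toFun := fun a => xs i ((a : X →L[ℝ] X) (x j))
      map_add' := fun a b => by simp
      map_smul' := fun r a => by simp } with hcdef
  have hu : ∀ i j, q i * u i j * q j = u i j := by
    intro i j
    ext y
    simp [hqcoe, hudef, hbi]
  have hc : ∀ i j a, q i * a * q j = c i j a • u i j := by
    intro i j a
    ext y
    simp [hqcoe, hudef, hcdef, smul_smul, mul_comm]
  obtain ⟨Q, hQ⟩ := exists_positive_majorant (P := fun a : S => IsPosOp (a : X →L[ℝ] X))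
    hL hR hLR hD' hq hD'q hu hc hLpos hRpos hPq
    (fun a ha i j => coord_nonneg hx hbi hbasis i (ha _ (hx j).1.le)) hPsub he' hM hKL hKR
    hrow hcol
  obtain ⟨g, hg0, hg1, -⟩ := exists_dual_modulus η
  have hg2 : dualLe 0 (g - η) := fun y hy => by simpa using hg1 y hy
  refine ⟨Q + L.flip g + R.flip (g - η), (Q - D') + L.flip (g - η) + R.flip g, ?_,
    fun a ha => ⟨fun y hy => ?_, fun y hy => ?_⟩⟩
  · ext1 a
    simp only [LinearMap.sub_apply, LinearMap.add_apply, LinearMap.flip_apply, hD'apply, map_sub]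
    abel
  · have h1 := (hQ a ha).1 y hy
    have h2 := hLpos a ha g hg0 y hy
    have h3 := hRpos a ha _ hg2 y hy
    simp only [zero_apply] at h1 h2 h3
    simp only [zero_apply, LinearMap.add_apply, LinearMap.flip_apply, add_apply]
    positivity
  · have h1 := (hQ a ha).2 y hy
    have h2 := hLpos a ha _ hg2 y hy
    have h3 := hRpos a ha g hg0 y hy
    simp only [zero_apply] at h2 h3
    simp only [zero_apply, LinearMap.add_apply, LinearMap.sub_apply, LinearMap.flip_apply,
      add_apply, sub_apply]
    linarith

end OperatorAlgebra

theorem atomic_main_regularity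
    {X 𝔛 : Type*} [NormedAddCommGroup X] [Lattice X] [HasSolidNorm X] [IsOrderedAddMonoid X] [NormedSpace ℝ X] [CompleteSpace X]
    [NormedAddCommGroup 𝔛] [Lattice 𝔛] [HasSolidNorm 𝔛] [IsOrderedAddMonoid 𝔛] [NormedSpace ℝ 𝔛] [CompleteSpace 𝔛]
    -- X = (⊕ᵢ Xᵢ)_𝐞 is order complete:
    (hXoc : ∀ S : Set X, S.Nonempty → BddAbove S → ∃ b, IsLUB S b)
    (μ : ℝ) (hμ : 1 ≤ μ)
    -- (x i) is a basis for X satisfying (⋆) with constant μ in each summand,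
    -- with biorthogonal functionals (xs i):
    (x : ℕ → X) (xs : ℕ → X →L[ℝ] ℝ)
    (hstar : StarSummandBasis μ x)
    (hbi : ∀ i j, xs i (x j) = if i = j then (1 : ℝ) else 0)
    (hbasis : ∀ y : X, Tendsto (fun n => ∑ i ∈ Finset.range n, xs i y • x i) atTop (𝓝 y))
    -- (1) (x i) is shrinking:
    (hshrink : ∀ l : X →L[ℝ] ℝ,
      Tendsto (fun n => ‖l - ∑ i ∈ Finset.range n, l (x i) • xs i‖) atTop (𝓝 0))
    -- 𝒜 is a closed Riesz algebra ideal of ℒʳ(X) (containing the rank-one basis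
    -- operators, so that the module products below make sense), with 𝒜𝒜 = 𝒜:
    (A : Set (X →L[ℝ] X))
    (hAsub : A ⊆ LrSet X)
    (hAadd : ∀ a ∈ A, ∀ b ∈ A, a + b ∈ A)
    (hAsmul : ∀ (c : ℝ), ∀ a ∈ A, c • a ∈ A)
    (hAideal : ∀ a ∈ A, ∀ T ∈ LrSet X, T ∘L a ∈ A ∧ a ∘L T ∈ A)
    (hARiesz : ∀ a ∈ A, ∃ m ∈ A, opLe a m ∧ opLe (-a) m ∧
      ∀ c ∈ LrSet X, opLe a c → opLe (-a) c → opLe m c)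
    (hAclosed : ∀ T ∈ LrSet X, (∀ ε : ℝ, 0 < ε → ∃ a ∈ A, rnorm (T - a) < ε) → T ∈ A)
    (hArk : ∀ i j : ℕ, ((xs j).smulRight (x i)) ∈ A)
    (hAA : ∀ c ∈ A, ∃ a ∈ A, ∃ b ∈ A, c = a ∘L b)
    -- 𝔛 is a Banach lattice 𝒜-module, with actions Ml, Mr and constant M:
    (Ml Mr : (X →L[ℝ] X) → 𝔛 → 𝔛) (M : ℝ)
    (hMladd : ∀ a ∈ A, ∀ y₁ y₂ : 𝔛, Ml a (y₁ + y₂) = Ml a y₁ + Ml a y₂)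
    (hMradd : ∀ a ∈ A, ∀ y₁ y₂ : 𝔛, Mr a (y₁ + y₂) = Mr a y₁ + Mr a y₂)
    (hMllin : ∀ a ∈ A, ∀ b ∈ A, ∀ (s t : ℝ) (y : 𝔛),
      Ml (s • a + t • b) y = s • Ml a y + t • Ml b y)
    (hMrlin : ∀ a ∈ A, ∀ b ∈ A, ∀ (s t : ℝ) (y : 𝔛),
      Mr (s • a + t • b) y = s • Mr a y + t • Mr b y)
    (hMlmul : ∀ a ∈ A, ∀ b ∈ A, ∀ y : 𝔛, Ml (a ∘L b) y = Ml a (Ml b y))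
    (hMrmul : ∀ a ∈ A, ∀ b ∈ A, ∀ y : 𝔛, Mr (a ∘L b) y = Mr b (Mr a y))
    (hMlr : ∀ a ∈ A, ∀ b ∈ A, ∀ y : 𝔛, Ml a (Mr b y) = Mr b (Ml a y))
    (hMpos : ∀ a ∈ A, IsPosOp a → ∀ y : 𝔛, 0 ≤ y → 0 ≤ Ml a y ∧ 0 ≤ Mr a y)
    (hMbd : ∀ a ∈ A, ∀ y : 𝔛, ‖Ml a y‖ ≤ M * rnorm a * ‖y‖ ∧ ‖Mr a y‖ ≤ M * rnorm a * ‖y‖)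
    -- dual module products on 𝔛′ := 𝔛 →L[ℝ] ℝ :
    (DL DR : (X →L[ℝ] X) → (𝔛 →L[ℝ] ℝ) → (𝔛 →L[ℝ] ℝ))
    (hDL : ∀ a ∈ A, ∀ (x' : 𝔛 →L[ℝ] ℝ) (y : 𝔛), DL a x' y = x' (Mr a y))
    (hDR : ∀ a ∈ A, ∀ (x' : 𝔛 →L[ℝ] ℝ) (y : 𝔛), DR a x' y = x' (Ml a y))
    -- (2) the linear maps E, F on 𝔛′ determined by Ex′ = sup_n e_n·x′ and
    -- Fx′ = sup_n x′·e_n have weak*-closed ranges: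
    (E F : (𝔛 →L[ℝ] ℝ) →ₗ[ℝ] (𝔛 →L[ℝ] ℝ))
    (hE : ∀ x' : 𝔛 →L[ℝ] ℝ, dualLe 0 x' →
      dualIsLUB (Set.range fun n =>
        DL (∑ i ∈ Finset.range n, (xs i).smulRight (x i)) x') (E x'))
    (hF : ∀ x' : 𝔛 →L[ℝ] ℝ, dualLe 0 x' →
      dualIsLUB (Set.range fun n =>
        DR (∑ i ∈ Finset.range n, (xs i).smulRight (x i)) x') (F x'))
    (hErange : wstarClosed (Set.range E))
    (hFrange : wstarClosed (Set.range F))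
    -- (3) sup_n e_n·(a·x′) = a·x′ and sup_n (x′·a)·e_n = x′·a :
    (hsup : ∀ a ∈ A, IsPosOp a → ∀ x' : 𝔛 →L[ℝ] ℝ, dualLe 0 x' →
      dualIsLUB (Set.range fun n =>
        DL (∑ i ∈ Finset.range n, (xs i).smulRight (x i)) (DL a x')) (DL a x') ∧
      dualIsLUB (Set.range fun n =>
        DR (∑ i ∈ Finset.range n, (xs i).smulRight (x i)) (DR a x')) (DR a x'))
    -- (4) at least one of (i), (ii), (iii) holds:
    (hcases :
      -- (i): no column or row sequence of corner spaces contains a subsequence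
      --      equivalent to the unit vector basis of c₀:
      (∀ i : ℕ, ∀ ξ : ℕ → (𝔛 →L[ℝ] ℝ),
        ((∀ n : ℕ, ∃ x' : 𝔛 →L[ℝ] ℝ,
            ξ n = DL ((xs n).smulRight (x n)) (DR ((xs i).smulRight (x i)) x')) ∨
         (∀ n : ℕ, ∃ x' : 𝔛 →L[ℝ] ℝ,
            ξ n = DL ((xs i).smulRight (x i)) (DR ((xs n).smulRight (x n)) x'))) →
        ¬ ∃ k : ℕ → ℕ, StrictMono k ∧ EquivC0Basis (fun n => ξ (k n))) ∨
      -- (ii): X is reflexive and some (hence every) corner space q_i·𝔛′·q_j is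
      --       finite dimensional:
      (Function.Surjective (NormedSpace.inclusionInDoubleDual ℝ X) ∧
        ∃ (i j n : ℕ) (b : Fin n → (𝔛 →L[ℝ] ℝ)),
          ∀ ξ : 𝔛 →L[ℝ] ℝ,
            (∃ x' : 𝔛 →L[ℝ] ℝ,
              ξ = DL ((xs i).smulRight (x i)) (DR ((xs j).smulRight (x j)) x')) →
            ∃ c : Fin n → ℝ, ξ = ∑ t, c t • b t) ∨
      -- (iii): every bounded derivation from 𝒜ʳ(X) to 𝔛′ is inner:
      (∀ D₀ : (X →L[ℝ] X) → (𝔛 →L[ℝ] ℝ),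
        (∀ a ∈ ArSet X, ∀ b ∈ ArSet X, D₀ (a + b) = D₀ a + D₀ b) →
        (∀ (r : ℝ), ∀ a ∈ ArSet X, D₀ (r • a) = r • D₀ a) →
        (∀ a ∈ ArSet X, ∀ b ∈ ArSet X, D₀ (a ∘L b) = DL a (D₀ b) + DR b (D₀ a)) →
        (∃ C : ℝ, ∀ a ∈ ArSet X, ‖D₀ a‖ ≤ C * rnorm a) →
        ∃ ξ : 𝔛 →L[ℝ] ℝ, ∀ a ∈ ArSet X, D₀ a = DL a ξ - DR a ξ))
    -- D is a bounded derivation from 𝒜 to 𝔛′: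
    (D : (X →L[ℝ] X) → (𝔛 →L[ℝ] ℝ))
    (hDadd : ∀ a ∈ A, ∀ b ∈ A, D (a + b) = D a + D b)
    (hDsmul : ∀ (r : ℝ), ∀ a ∈ A, D (r • a) = r • D a)
    (hDder : ∀ a ∈ A, ∀ b ∈ A, D (a ∘L b) = DL a (D b) + DR b (D a))
    (hDbdd : ∃ C : ℝ, ∀ a ∈ A, ‖D a‖ ≤ C * rnorm a) :
    RegularDerivOn A D := by
  have hx : ∀ i, IsNormAtom (x i) := by
    obtain ⟨I, ψ, -, -, -, hx, -⟩ := hstar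
    exact hx
  let S : NonUnitalSubalgebra ℝ (X →L[ℝ] X) :=
    { carrier := A
      add_mem' := fun {a b} ha hb => hAadd a ha b hb
      zero_mem' := by simpa using hAsmul 0 _ (hArk 0 0)
      mul_mem' := fun {a b} ha hb => (hAideal a ha b (hAsub hb)).2
      smul_mem' := fun r {a} ha => hAsmul r a ha }
  have hSA : ∀ a : S, (a : X →L[ℝ] X) ∈ A := fun a => a.2
  have hMladd' : ∀ (a b : S) y, Ml (a + b : X →L[ℝ] X) y = Ml a y + Ml b y := fun a b y => by
    simpa using hMllin a (hSA a) b (hSA b) 1 1 y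
  have hMradd' : ∀ (a b : S) y, Mr (a + b : X →L[ℝ] X) y = Mr a y + Mr b y := fun a b y => by
    simpa using hMrlin a (hSA a) b (hSA b) 1 1 y
  have hMlsmul : ∀ (r : ℝ) (a : S) y, Ml (r • a : X →L[ℝ] X) y = r • Ml a y := fun r a y => by
    simpa using hMllin a (hSA a) a (hSA a) r 0 y
  have hMrsmul : ∀ (r : ℝ) (a : S) y, Mr (r • a : X →L[ℝ] X) y = r • Mr a y := fun r a y => by
    simpa using hMrlin a (hSA a) a (hSA a) r 0 y
  let L : S →ₗ[ℝ] (𝔛 →L[ℝ] ℝ) →ₗ[ℝ] (𝔛 →L[ℝ] ℝ) :=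
    LinearMap.mk₂ ℝ (fun a v => DL a v)
      (fun a b v => by
        ext y
        rw [hDL _ (hSA (a + b)), add_apply, hDL _ (hSA a), hDL _ (hSA b), ← map_add, ← hMradd']
        rfl)
      (fun r a v => by
        ext y
        rw [hDL _ (hSA (r • a)), smul_apply, hDL _ (hSA a), ← map_smul, ← hMrsmul]
        rfl)
      (fun a v w => by
        ext y
        simp only [add_apply, hDL _ (hSA a)])
      (fun r a v => by
        ext y
        simp only [smul_apply, hDL _ (hSA a)])
  let R : S →ₗ[ℝ] (𝔛 →L[ℝ] ℝ) →ₗ[ℝ] (𝔛 →L[ℝ] ℝ) :=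
    LinearMap.mk₂ ℝ (fun a v => DR a v)
      (fun a b v => by
        ext y
        rw [hDR _ (hSA (a + b)), add_apply, hDR _ (hSA a), hDR _ (hSA b), ← map_add, ← hMladd']
        rfl)
      (fun r a v => by
        ext y
        rw [hDR _ (hSA (r • a)), smul_apply, hDR _ (hSA a), ← map_smul, ← hMlsmul]
        rfl)
      (fun a v w => by
        ext y
        simp only [add_apply, hDR _ (hSA a)])
      (fun r a v => by
        ext y
        simp only [smul_apply, hDR _ (hSA a)])
  have hLapp : ∀ (a : S) v y, L a v y = v (Mr a y) := fun a v y => hDL a (hSA a) v y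
  have hRapp : ∀ (a : S) v y, R a v y = v (Ml a y) := fun a v y => hDR a (hSA a) v y
  let D₁ : S →ₗ[ℝ] (𝔛 →L[ℝ] ℝ) :=
    { toFun := fun a => D a
      map_add' := fun a b => hDadd a (hSA a) b (hSA b)
      map_smul' := fun r a => hDsmul r a (hSA a) }
  obtain ⟨C, hC⟩ := hDbdd
  have hbound : ∀ a : S, ∀ y z : 𝔛, ‖z‖ ≤ M * rnorm (a : X →L[ℝ] X) * ‖y‖ →
      ∀ v : 𝔛 →L[ℝ] ℝ, ‖v z‖ ≤ |M| * rnorm (a : X →L[ℝ] X) * ‖v‖ * ‖y‖ := by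
    intro a y z hz v
    calc ‖v z‖ ≤ ‖v‖ * ‖z‖ := v.le_opNorm z
      _ ≤ ‖v‖ * (|M| * rnorm (a : X →L[ℝ] X) * ‖y‖) := by
          refine mul_le_mul_of_nonneg_left (hz.trans ?_) (norm_nonneg v)
          have := rnorm_nonneg (a : X →L[ℝ] X)
          gcongr
          exact le_abs_self M
      _ = |M| * rnorm (a : X →L[ℝ] X) * ‖v‖ * ‖y‖ := by ring
  have hnonneg : ∀ (a : S) (v : 𝔛 →L[ℝ] ℝ), 0 ≤ |M| * rnorm (a : X →L[ℝ] X) * ‖v‖ := fun a v =>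
    mul_nonneg (mul_nonneg (abs_nonneg M) (rnorm_nonneg _)) (norm_nonneg v)
  have hPsub : ∀ a : S, ∃ b b' : S, IsPosOp (b : X →L[ℝ] X) ∧ IsPosOp (b' : X →L[ℝ] X) ∧
      a = b - b' := by
    intro a
    obtain ⟨m, hm, h1, h2, -⟩ := hARiesz a (hSA a)
    refine ⟨⟨m, hm⟩, ⟨m, hm⟩ - a, fun y hy => ?_, fun y hy => by simpa using h1 y hy,
      (sub_sub_cancel _ _).symm⟩
    have h3 := add_nonneg (h1 y hy) (h2 y hy)
    have h4 : (m - (a : X →L[ℝ] X)) y + (m - -(a : X →L[ℝ] X)) y = (2 : ℝ) • m y := by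
      rw [two_smul, sub_apply, sub_apply, neg_apply]
      abel
    rw [h4] at h3
    have h5 := solid_smul_nonneg (by norm_num : (0 : ℝ) ≤ 2⁻¹) h3
    rwa [smul_smul, inv_mul_cancel₀ two_ne_zero, one_smul] at h5
  let e : ℕ → S := fun n => ∑ i ∈ Finset.range n, ⟨(xs i).smulRight (x i), hArk i i⟩
  have hecoe : ∀ n, (e n : X →L[ℝ] X) = ∑ i ∈ Finset.range n, (xs i).smulRight (x i) :=
    fun n => AddSubmonoidClass.coe_finsetSum _ _
  obtain ⟨Q₁, Q₂, hQ, hQpos⟩ := derivation_eq_sub_of_positive (S := S) (L := L) (R := R) (D := D₁)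
    (M := |M|) (C := |C|) hx hbi hbasis hshrink (fun i j => hArk i j)
    (fun a b v => by
      ext y
      rw [hLapp, hLapp, hLapp, ← hMrmul _ (hSA a) _ (hSA b)]
      rfl)
    (fun a b v => by
      ext y
      rw [hRapp, hRapp, hRapp, ← hMlmul _ (hSA a) _ (hSA b)]
      rfl)
    (fun a b v => by
      ext y
      rw [hLapp, hRapp, hRapp, hLapp, hMlr _ (hSA b) _ (hSA a)])
    (fun a b => hDder a (hSA a) b (hSA b))
    (fun a φ ψ h y => by simpa only [hLapp] using h (Mr a y))
    (fun a φ ψ h y => by simpa only [hRapp] using h (Ml a y))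
    (fun a ha v hv y hy => by
      rw [hLapp]
      exact hv _ (hMpos _ (hSA a) ha y hy).2)
    (fun a ha v hv y hy => by
      rw [hRapp]
      exact hv _ (hMpos _ (hSA a) ha y hy).1)
    (abs_nonneg M)
    (fun a v => (L a v).opNorm_le_bound (hnonneg a v) fun y => by
      rw [hLapp]
      exact hbound a y _ (hMbd _ (hSA a) y).2 v)
    (fun a v => (R a v).opNorm_le_bound (hnonneg a v) fun y => by
      rw [hRapp]
      exact hbound a y _ (hMbd _ (hSA a) y).1 v)
    (abs_nonneg C)
    (fun a => (hC _ (hSA a)).trans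
      (mul_le_mul_of_nonneg_right (le_abs_self C) (rnorm_nonneg _)))
    hPsub (e := e) (fun _ => rfl)
    (fun a ha v hv => by
      have h := (hsup _ (hSA a) ha v hv).1
      simp only [← hecoe] at h
      exact h)
    (fun a ha v hv => by
      have h := (hsup _ (hSA a) ha v hv).2
      simp only [← hecoe] at h
      exact h)
    (fun c => by
      obtain ⟨a, ha, b, hb, h⟩ := hAA _ (hSA c)
      exact ⟨⟨a, ha⟩, ⟨b, hb⟩, Subtype.ext h⟩)
  classical
  have key : ∀ Q : S →ₗ[ℝ] (𝔛 →L[ℝ] ℝ),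
      (∀ a : S, IsPosOp (a : X →L[ℝ] X) → dualLe 0 (Q a)) →
      ∃ P : (X →L[ℝ] X) → (𝔛 →L[ℝ] ℝ), (∀ a : S, P a = Q a) ∧
        (∀ a ∈ A, ∀ b ∈ A, P (a + b) = P a + P b) ∧
        (∀ (r : ℝ), ∀ a ∈ A, P (r • a) = r • P a) ∧
        (∀ a ∈ A, IsPosOp a → dualLe 0 (P a)) := by
    intro Q hQ0
    obtain ⟨P, hP⟩ : ∃ P : (X →L[ℝ] X) → (𝔛 →L[ℝ] ℝ), ∀ a : S, P a = Q a :=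
      ⟨fun T => if h : T ∈ A then Q ⟨T, h⟩ else 0, fun a => dif_pos (hSA a)⟩
    refine ⟨P, hP, fun a ha b hb => ?_, fun r a ha => ?_, fun a ha hpos => ?_⟩
    · exact (hP (⟨a, ha⟩ + ⟨b, hb⟩)).trans (by rw [map_add, ← hP, ← hP])
    · exact (hP (r • ⟨a, ha⟩)).trans (by rw [map_smul, ← hP])
    · have := hQ0 ⟨a, ha⟩ hpos
      rwa [← hP] at this
  obtain ⟨P₁, hP₁, hP₁'⟩ := key Q₁ fun a ha => (hQpos a ha).1
  obtain ⟨P₂, hP₂, hP₂'⟩ := key Q₂ fun a ha => (hQpos a ha).2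
  refine ⟨2, ![1, -1], ![P₁, P₂], fun t => ?_, fun a ha => ?_⟩
  · fin_cases t
    exacts [hP₁', hP₂']
  · have h1 : D a = Q₁ ⟨a, ha⟩ - Q₂ ⟨a, ha⟩ := by
      rw [← LinearMap.sub_apply, ← hQ]
      rfl
    rw [h1, ← hP₁, ← hP₂, Fin.sum_univ_two]
    ext y
    change P₁ a y - P₂ a y = 1 * P₁ a y + (-1) * P₂ a y
    ring
end
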